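/- arXiv:1803.09703 — 5 statements merged into one kernel-verified Lean document; each statement's English description precedes it below -/
import Mathlib

section
/- Let w be a nonempty computation with ⟦w⟧ = 1 and let w = w₁⋯w_k be its context decomposition, and assume that every context wᵢ is irreducible. Then each context admits a factorization wᵢ = w_{i,1}·w_{i,2}⋯w_{i,m_i} with m_i ≤ k − 1 such that the combined sequence w_{1,1}, …, w_{1,m_1}, w_{2,1}, …, w_{2,m_2}, …, w_{k,1}, …, w_{k,m_k} is freely reducible; in particular, the number of pieces in this decomposition is at most k². -/
/-- Operations on the symbols of a graph: a positive (`o⁺`) and a negative (`o⁻`)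
operation for each symbol `o`. -/
inductive Op (V : Type) : Type
  | pos : V → Op V
  | neg : V → Op V

/-- The underlying symbol of an operation. -/
def Op.sym {V : Type} : Op V → V
  | .pos o => o
  | .neg o => o
/-- The generating relation of the graph monoid congruence, closed under contexts:
swap two adjacent independent operations, or cancel an adjacent pair `o⁺ o⁻`. -/
inductive MGen {V : Type} (I : V → V → Prop) : List (Op V) → List (Op V) → Prop
  | swap (s t : List (Op V)) (a b : Op V) (h : I a.sym b.sym) :
      MGen I (s ++ [a, b] ++ t) (s ++ [b, a] ++ t)
  | cancel (s t : List (Op V)) (o : V) :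
      MGen I (s ++ [Op.pos o, Op.neg o] ++ t) (s ++ t)

/-- The monoid congruence `≅` on computations: the smallest congruence containing
`o₁^± o₂^± ≅ o₂^± o₁^±` for `(o₁,o₂) ∈ I` and `o⁺ o⁻ ≅ ε`.  In particular
`MCong I w []` expresses `⟦w⟧ = 1`. -/
def MCong {V : Type} (I : V → V → Prop) : List (Op V) → List (Op V) → Prop :=
  Relation.EqvGen (MGen I)
/-- A computation is dependent if no two distinct symbols occurring in it are
`I`-related. -/
def DependentWord {V : Type} (I : V → V → Prop) (w : List (Op V)) : Prop :=
  ∀ a ∈ w, ∀ b ∈ w, Op.sym a ≠ Op.sym b → ¬ I (Op.sym a) (Op.sym b)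
/-- `cs` is the context decomposition of the nonempty computation `w`: the pieces
are nonempty and dependent, they concatenate to `w`, and each context is maximal,
i.e. it cannot be extended by the first letter of the next context while staying
dependent. -/
def IsContextDecomp {V : Type} (I : V → V → Prop) (w : List (Op V))
    (cs : List (List (Op V))) : Prop :=
  cs.flatten = w ∧ cs ≠ [] ∧ (∀ c ∈ cs, c ≠ [] ∧ DependentWord I c) ∧
    List.Chain' (fun c d => ∀ a ∈ d.head?, ¬ DependentWord I (c ++ [a])) cs

/-- `HasCS I w m` expresses that the number of context switches of `w` is `m`,
i.e. `cs(w) = m`, where `cs(ε) = -1` and otherwise `cs(w)` is the number of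
contexts of `w` minus one. -/
def HasCS {V : Type} (I : V → V → Prop) (w : List (Op V)) (m : ℤ) : Prop :=
  (w = [] ∧ m = -1) ∨
    ∃ cs : List (List (Op V)), IsContextDecomp I w cs ∧ m = (cs.length : ℤ) - 1
/-- A computation is irreducible if no pair `o⁺ … o⁻` (or `o⁻ … o⁺` when `(o,o) ∈ I`)
can be cancelled after commuting, i.e. it has no factorization `w' a u b w''` where
`a, b` are complementary operations on a symbol `o` that is `I`-related to every
symbol occurring in `u`. -/
def IrreducibleComp {V : Type} (I : V → V → Prop) (w : List (Op V)) : Prop :=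
  ¬ ∃ (w' u w'' : List (Op V)) (o : V),
    (w = w' ++ [Op.pos o] ++ u ++ [Op.neg o] ++ w'' ∧ ∀ a ∈ u, I o (Op.sym a)) ∨
    (w = w' ++ [Op.neg o] ++ u ++ [Op.pos o] ++ w'' ∧ I o o ∧ ∀ a ∈ u, I o (Op.sym a))
/-- One step of a free reduction on a sequence of computations:
(FR1) delete two consecutive entries whose concatenation is `≅ ε`;
(FR2) swap two consecutive entries all of whose operations are mutually independent. -/
inductive FRStep {V : Type} (I : V → V → Prop) :
    List (List (Op V)) → List (List (Op V)) → Prop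
  | cancel (pre post : List (List (Op V))) (u v : List (Op V))
      (h : MCong I (u ++ v) []) :
      FRStep I (pre ++ [u, v] ++ post) (pre ++ post)
  | swap (pre post : List (List (Op V))) (u v : List (Op V))
      (h : ∀ a ∈ u, ∀ b ∈ v, I (Op.sym a) (Op.sym b)) :
      FRStep I (pre ++ [u, v] ++ post) (pre ++ [v, u] ++ post)

/-- A sequence of computations is freely reducible if finitely many applications of
(FR1) and (FR2) transform it into the empty sequence. -/
def FreelyReducible {V : Type} (I : V → V → Prop) (ws : List (List (Op V))) : Prop :=
  Relation.ReflTransGen (FRStep I) ws []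


/-- `a` followed by `b` cancels: `o⁺ o⁻`, or `o⁻ o⁺` for a symbol with a self-loop. -/
def Cancels {V : Type} (I : V → V → Prop) (a b : Op V) : Prop :=
  ∃ o, (a = .pos o ∧ b = .neg o) ∨ (I o o ∧ a = .neg o ∧ b = .pos o)

theorem Cancels.sym_eq {V : Type} {I : V → V → Prop} {a b : Op V} (h : Cancels I a b) :
    a.sym = b.sym := by
  obtain ⟨o, ⟨rfl, rfl⟩ | ⟨_, rfl, rfl⟩⟩ := h <;> rfl

/-- `f` is a perfect matching of the positions of the word `ℓ 0, …, ℓ (n-1)` which pairs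
cancelling operations, such that crossing pairs have distinct independent symbols. -/
structure IsMatching {V : Type} (I : V → V → Prop) (n : ℕ) (ℓ : ℕ → Op V) (f : ℕ → ℕ) :
    Prop where
  lt : ∀ i < n, f i < n
  inv : ∀ i < n, f (f i) = i
  ne : ∀ i < n, f i ≠ i
  cancels : ∀ i < n, i < f i → Cancels I (ℓ i) (ℓ (f i))
  cross : ∀ i j, i < j → j < f i → f i < f j → f j < n →
    I (ℓ i).sym (ℓ j).sym ∧ (ℓ i).sym ≠ (ℓ j).sym

section
variable {V : Type} {I : V → V → Prop} {n : ℕ} {ℓ : ℕ → Op V} {f : ℕ → ℕ}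

theorem IsMatching.sym_eq (h : IsMatching I n ℓ f) {i : ℕ} (hi : i < n) :
    (ℓ (f i)).sym = (ℓ i).sym := by
  rcases lt_trichotomy i (f i) with h1 | h1 | h1
  · exact (h.cancels i hi h1).sym_eq.symm
  · exact absurd h1.symm (h.ne i hi)
  · have := h.cancels (f i) (h.lt i hi) (by rwa [h.inv i hi])
    rw [h.inv i hi] at this
    exact this.sym_eq

/-- The order embedding of `ℕ` that leaves out `p` and `p + 1`. -/
def skipTwo (p i : ℕ) : ℕ := if i < p then i else i + 2

theorem skipTwo_lt_skipTwo {p i j : ℕ} : skipTwo p i < skipTwo p j ↔ i < j := by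
  unfold skipTwo; split_ifs <;> omega

theorem skipTwo_inj {p i j : ℕ} : skipTwo p i = skipTwo p j ↔ i = j := by
  unfold skipTwo; split_ifs <;> omega

theorem skipTwo_lt {p i : ℕ} (hp : p ≤ n) : skipTwo p i < n + 2 ↔ i < n := by
  unfold skipTwo; split_ifs <;> omega

theorem eq_or_exists_skipTwo (p i : ℕ) : i = p ∨ i = p + 1 ∨ ∃ j, i = skipTwo p j := by
  rcases lt_trichotomy i p with h | h | h
  · exact .inr (.inr ⟨i, by simp [skipTwo, h]⟩)
  · exact .inl h
  · by_cases h' : i = p + 1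
    · exact .inr (.inl h')
    · exact .inr (.inr ⟨i - 2, by unfold skipTwo; split_ifs <;> omega⟩)

theorem skipTwo_ne (p i : ℕ) : skipTwo p i ≠ p ∧ skipTwo p i ≠ p + 1 := by
  unfold skipTwo; split_ifs <;> omega

/-- Deleting a matched pair of adjacent positions. -/
theorem IsMatching.delete {p : ℕ} (h : IsMatching I (n + 2) ℓ f) (hp : p ≤ n)
    (hf : f p = p + 1) : ∃ g, IsMatching I n (fun i => ℓ (skipTwo p i)) g := by
  have hf' : f (p + 1) = p := by rw [← hf]; exact h.inv p (by omega)
  have key : ∀ i, ∃ j, i < n → f (skipTwo p i) = skipTwo p j := by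
    intro i
    by_cases hi : i < n
    · have hinv := h.inv _ ((skipTwo_lt hp).2 hi)
      have hne := skipTwo_ne p i
      rcases eq_or_exists_skipTwo p (f (skipTwo p i)) with h2 | h2 | ⟨j, hj⟩
      · rw [h2, hf] at hinv; omega
      · rw [h2, hf'] at hinv; omega
      · exact ⟨j, fun _ => hj⟩
    · exact ⟨0, fun h => absurd h hi⟩
  choose g hg using key
  have hlt : ∀ i < n, g i < n := fun i hi => by
    rw [← skipTwo_lt hp, ← hg i hi]
    exact h.lt _ ((skipTwo_lt hp).2 hi)
  refine ⟨g, hlt, ?_, ?_, ?_, ?_⟩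
  · intro i hi
    rw [← skipTwo_inj (p := p), ← hg _ (hlt i hi), ← hg i hi]
    exact h.inv _ ((skipTwo_lt hp).2 hi)
  · intro i hi
    rw [Ne, ← skipTwo_inj (p := p), ← hg i hi]
    exact h.ne _ ((skipTwo_lt hp).2 hi)
  · intro i hi hl
    rw [← skipTwo_lt_skipTwo (p := p), ← hg i hi] at hl
    have := h.cancels _ ((skipTwo_lt hp).2 hi) hl
    rwa [hg i hi] at this
  · intro i j hij hj h1 h2
    by_cases hjn : j < n
    · apply h.cross _ _ (skipTwo_lt_skipTwo.2 hij)
      · rwa [hg i (by omega), skipTwo_lt_skipTwo]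
      · rwa [hg i (by omega), hg j hjn, skipTwo_lt_skipTwo]
      · rwa [hg j hjn, skipTwo_lt hp]
    · omega

/-- Inserting a matched pair of adjacent positions. -/
theorem IsMatching.insert {p : ℕ} {m : ℕ → Op V} (h : IsMatching I n ℓ f) (hp : p ≤ n)
    (hab : Cancels I (m p) (m (p + 1))) (hm : ∀ i < n, m (skipTwo p i) = ℓ i) :
    ∃ g, IsMatching I (n + 2) m g := by
  obtain ⟨g, hg, hg1, hg2⟩ : ∃ g : ℕ → ℕ, (∀ i, g (skipTwo p i) = skipTwo p (f i)) ∧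
      g p = p + 1 ∧ g (p + 1) = p := by
    have key : ∀ i, ∃ x, (i = p → x = p + 1) ∧ (i = p + 1 → x = p) ∧
        ∀ j, i = skipTwo p j → x = skipTwo p (f j) := by
      intro i
      rcases eq_or_exists_skipTwo p i with rfl | rfl | ⟨j, rfl⟩
      · exact ⟨_, fun _ => rfl, by omega, fun j hj => absurd hj.symm (skipTwo_ne _ j).1⟩
      · exact ⟨p, by omega, fun _ => rfl, fun j hj => absurd hj.symm (skipTwo_ne _ j).2⟩
      · refine ⟨skipTwo p (f j), fun hj => absurd hj (skipTwo_ne _ j).1,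
          fun hj => absurd hj (skipTwo_ne _ j).2, fun k hk => ?_⟩
        rw [skipTwo_inj.1 hk]
    choose g h1 h2 h3 using key
    exact ⟨g, fun i => h3 _ _ rfl, h1 _ rfl, h2 _ rfl⟩
  refine ⟨g, ?_, ?_, ?_, ?_, ?_⟩
  · intro i hi
    rcases eq_or_exists_skipTwo p i with rfl | rfl | ⟨i, rfl⟩
    · omega
    · omega
    · rw [hg, skipTwo_lt hp]
      exact h.lt i ((skipTwo_lt hp).1 hi)
  · intro i hi
    rcases eq_or_exists_skipTwo p i with rfl | rfl | ⟨i, rfl⟩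
    · rw [hg1, hg2]
    · rw [hg2, hg1]
    · rw [hg, hg, h.inv i ((skipTwo_lt hp).1 hi)]
  · intro i hi
    rcases eq_or_exists_skipTwo p i with rfl | rfl | ⟨i, rfl⟩
    · omega
    · omega
    · rw [hg, Ne, skipTwo_inj]
      exact h.ne i ((skipTwo_lt hp).1 hi)
  · intro i hi hl
    rcases eq_or_exists_skipTwo p i with rfl | rfl | ⟨i, rfl⟩
    · rwa [hg1]
    · omega
    · have hi' := (skipTwo_lt hp).1 hi
      rw [hg, skipTwo_lt_skipTwo] at hl
      rw [hg, hm _ hi', hm _ (h.lt i hi')]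
      exact h.cancels i hi' hl
  · intro i j hij hj h1 h2
    rcases eq_or_exists_skipTwo p i with rfl | rfl | ⟨i, rfl⟩
    · omega
    · omega
    rcases eq_or_exists_skipTwo p j with rfl | rfl | ⟨j, rfl⟩
    · omega
    · omega
    simp only [hg, skipTwo_lt_skipTwo, skipTwo_lt hp] at hij hj h1 h2
    by_cases hjn : j < n
    · rw [hm i (by omega), hm j hjn]
      exact h.cross i j hij hj h1 h2
    · omega

/-- The transposition of `p` and `p + 1`. -/
def adjSwap (p i : ℕ) : ℕ := if i = p then p + 1 else if i = p + 1 then p else i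

theorem adjSwap_adjSwap (p i : ℕ) : adjSwap p (adjSwap p i) = i := by
  unfold adjSwap; split_ifs <;> omega

theorem adjSwap_lt {p i : ℕ} (hp : p + 1 < n) : adjSwap p i < n ↔ i < n := by
  unfold adjSwap; split_ifs <;> omega

theorem lt_or_of_adjSwap_lt {p i j : ℕ} (h : adjSwap p i < adjSwap p j) :
    i < j ∨ (i = p + 1 ∧ j = p) := by
  unfold adjSwap at h; split_ifs at h <;> omega

/-- Exchanging adjacent positions with distinct independent symbols. -/
theorem IsMatching.swap (hsym : ∀ a b : V, I a b → I b a) {p : ℕ} (h : IsMatching I n ℓ f)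
    (hp : p + 1 < n) (hI : I (ℓ p).sym (ℓ (p + 1)).sym) (hne : (ℓ p).sym ≠ (ℓ (p + 1)).sym) :
    IsMatching I n (fun i => ℓ (adjSwap p i)) (fun i => adjSwap p (f (adjSwap p i))) := by
  have hlt : ∀ i < n, adjSwap p i < n := fun i hi => (adjSwap_lt hp).2 hi
  refine ⟨fun i hi => hlt _ (h.lt _ (hlt i hi)), ?_, ?_, ?_, ?_⟩
  · intro i hi
    rw [adjSwap_adjSwap, h.inv _ (hlt i hi), adjSwap_adjSwap]
  · intro i hi he
    refine h.ne _ (hlt i hi) ?_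
    rw [← adjSwap_adjSwap p (f _), he]
  · intro i hi hl
    obtain ⟨i, rfl⟩ : ∃ i', i = adjSwap p i' := ⟨_, (adjSwap_adjSwap p i).symm⟩
    simp only [adjSwap_adjSwap, adjSwap_lt hp] at *
    rcases lt_or_of_adjSwap_lt hl with h1 | ⟨h1, h2⟩
    · exact h.cancels i hi h1
    · refine absurd ?_ hne
      rw [← h1, ← h2]
      exact h.sym_eq hi
  · intro i j hij hj h1 h2
    have hjn : j < n := by
      by_contra hc
      unfold adjSwap at *
      grind
    obtain ⟨i, rfl⟩ : ∃ i', i = adjSwap p i' := ⟨_, (adjSwap_adjSwap p i).symm⟩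
    obtain ⟨j, rfl⟩ : ∃ j', j = adjSwap p j' := ⟨_, (adjSwap_adjSwap p j).symm⟩
    simp only [adjSwap_adjSwap, adjSwap_lt hp] at *
    have hi : i < n := (adjSwap_lt hp).1 (hij.trans ((adjSwap_lt hp).2 hjn))
    have si := h.sym_eq hi
    have sj := h.sym_eq hjn
    have hI' := hsym _ _ hI
    rcases lt_or_of_adjSwap_lt hij with a1 | ⟨a1, a2⟩
    · rcases lt_or_of_adjSwap_lt hj with b1 | ⟨b1, b2⟩
      · rcases lt_or_of_adjSwap_lt h1 with c1 | ⟨c1, c2⟩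
        · exact h.cross i j a1 b1 c1 h2
        · rw [← si, ← sj, c1, c2]
          exact ⟨hI', hne.symm⟩
      · rw [← si, b1, b2]
        exact ⟨hI, hne⟩
    · rw [a1, a2]
      exact ⟨hI', hne.symm⟩

theorem IsMatching.eq_neg (h : IsMatching I n ℓ f) {i : ℕ} {o : V} (hi : i < n)
    (ho : ℓ i = .pos o) : ℓ (f i) = .neg o ∧ (f i < i → I o o) := by
  have h1 := h.cancels i hi
  have h2 := h.cancels (f i) (h.lt i hi)
  rw [h.inv i hi] at h2
  have h3 := h.ne i hi
  rcases lt_or_gt_of_ne h3 with h4 | h4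
  · obtain ⟨q, hq⟩ := h2 h4
    grind
  · obtain ⟨q, hq⟩ := h1 h4
    grind

theorem IsMatching.eq_pos (h : IsMatching I n ℓ f) {i : ℕ} {o : V} (hi : i < n)
    (ho : ℓ i = .neg o) : ℓ (f i) = .pos o ∧ (i < f i → I o o) := by
  have h1 := h.cancels i hi
  have h2 := h.cancels (f i) (h.lt i hi)
  rw [h.inv i hi] at h2
  have h3 := h.ne i hi
  rcases lt_or_gt_of_ne h3 with h4 | h4
  · obtain ⟨q, hq⟩ := h2 h4
    grind
  · obtain ⟨q, hq⟩ := h1 h4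
    grind

/-- A matching can be changed so that it pairs two given adjacent cancelling positions. -/
theorem IsMatching.rematch (hsym : ∀ a b : V, I a b → I b a) {p : ℕ} (h : IsMatching I n ℓ f)
    (hp : p + 1 < n) (hc : Cancels I (ℓ p) (ℓ (p + 1))) :
    ∃ g, IsMatching I n ℓ g ∧ g p = p + 1 := by
  by_cases e : f p = p + 1
  · exact ⟨f, h, e⟩
  obtain ⟨x, hx⟩ : ∃ x, f p = x := ⟨_, rfl⟩
  obtain ⟨y, hy⟩ : ∃ y, f (p + 1) = y := ⟨_, rfl⟩
  have hx' : f x = p := by rw [← hx]; exact h.inv p (by omega)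
  have hy' : f y = p + 1 := by rw [← hy]; exact h.inv _ hp
  have hxn : x < n := hx ▸ h.lt p (by omega)
  have hyn : y < n := hy ▸ h.lt _ hp
  have hxp : x ≠ p := hx ▸ h.ne p (by omega)
  have hxp' : x ≠ p + 1 := by omega
  have hyp' : y ≠ p + 1 := hy ▸ h.ne _ hp
  have hyp : y ≠ p := by rintro rfl; omega
  have hxy : x ≠ y := by rintro rfl; omega
  have s1 := h.sym_eq (i := p) (by omega)
  have s2 := h.sym_eq hp
  rw [hx] at s1
  rw [hy, ← hc.sym_eq] at s2
  obtain ⟨g, g1, g2, g3, g4, g5⟩ : ∃ g : ℕ → ℕ, g p = p + 1 ∧ g (p + 1) = p ∧ g x = y ∧ g y = x ∧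
      ∀ i, i ≠ p → i ≠ p + 1 → i ≠ x → i ≠ y → g i = f i := by
    refine ⟨fun i => if i = p then p + 1 else if i = p + 1 then p else if i = x then y else
      if i = y then x else f i, ?_, ?_, ?_, ?_, ?_⟩ <;> grind
  have cases5 : ∀ i, i = p ∨ i = p + 1 ∨ i = x ∨ i = y ∨
      (i ≠ p ∧ i ≠ p + 1 ∧ i ≠ x ∧ i ≠ y ∧ g i = f i) := by
    grind
  have hinv : ∀ i < n, i ≠ p → i ≠ p + 1 → i ≠ x → i ≠ y →
      f i ≠ p ∧ f i ≠ p + 1 ∧ f i ≠ x ∧ f i ≠ y := by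
    intro i hi _ _ _ _
    have := h.inv i hi
    refine ⟨?_, ?_, ?_, ?_⟩ <;> intro e <;> rw [e] at this <;> omega
  refine ⟨g, ⟨?_, ?_, ?_, ?_, ?_⟩, g1⟩
  · intro i hi
    rcases cases5 i with rfl | rfl | rfl | rfl | ⟨_, _, _, _, e⟩ <;> try omega
    rw [e]
    exact h.lt i hi
  · intro i hi
    rcases cases5 i with rfl | rfl | rfl | rfl | ⟨i1, i2, i3, i4, e⟩ <;> try grind
    obtain ⟨j1, j2, j3, j4⟩ := hinv i hi i1 i2 i3 i4
    rw [e, g5 _ j1 j2 j3 j4, h.inv i hi]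
  · intro i hi
    rcases cases5 i with rfl | rfl | rfl | rfl | ⟨_, _, _, _, e⟩ <;> try omega
    rw [e]
    exact h.ne i hi
  · intro i hi hl
    have cxy : (x < y → Cancels I (ℓ x) (ℓ y)) ∧ (y < x → Cancels I (ℓ y) (ℓ x)) := by
      obtain ⟨o, ⟨h1, h2⟩ | ⟨h0, h1, h2⟩⟩ := hc
      · have k1 := h.eq_neg (by omega) h1
        have k2 := h.eq_pos hp h2
        rw [hx] at k1
        rw [hy] at k2
        refine ⟨fun hl => ⟨o, .inr ⟨?_, k1.1, k2.1⟩⟩, fun _ => ⟨o, .inl ⟨k2.1, k1.1⟩⟩⟩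
        by_cases hxl : x < p
        · exact k1.2 hxl
        · exact k2.2 (by omega)
      · have k1 := h.eq_pos (by omega) h1
        have k2 := h.eq_neg hp h2
        rw [hx] at k1
        rw [hy] at k2
        exact ⟨fun _ => ⟨o, .inl ⟨k1.1, k2.1⟩⟩, fun _ => ⟨o, .inr ⟨h0, k2.1, k1.1⟩⟩⟩
    rcases cases5 i with rfl | rfl | rfl | rfl | ⟨_, _, _, _, e⟩
    · rwa [g1]
    · omega
    · rw [g3] at hl ⊢
      exact cxy.1 hl
    · rw [g4] at hl ⊢
      exact cxy.2 hl
    · rw [e] at hl ⊢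
      exact h.cancels i hi hl
  · have sxp : (ℓ (p + 1)).sym = (ℓ p).sym := hc.sym_eq.symm
    have hr : ∀ {a b : V}, I a b ∧ a ≠ b → I b a ∧ b ≠ a := fun h => ⟨hsym _ _ h.1, h.2.symm⟩
    have sep : ∀ c, c ≠ p → c ≠ p + 1 → c ≠ x → c ≠ y → c < f c → f c < n →
        ((c < x ∧ x < f c ∧ (y < c ∨ f c < y)) ∨ (c < y ∧ y < f c ∧ (x < c ∨ f c < x))) →
        I (ℓ p).sym (ℓ c).sym ∧ (ℓ p).sym ≠ (ℓ c).sym := by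
      intro c c1 c2 c3 c4 hcl hcn hs
      have hcn' : c < n := hcl.trans hcn
      obtain ⟨d1, d2, d3, d4⟩ := hinv c hcn' c1 c2 c3 c4
      have k1 := h.cross c p
      have k2 := h.cross c (p + 1)
      have k3 := h.cross c x
      have k4 := h.cross c y
      have k5 := h.cross p c
      have k6 := h.cross (p + 1) c
      have k7 := h.cross x c
      have k8 := h.cross y c
      rw [hx, s1] at *
      grind
    intro i j hij hj hlt hn
    rcases cases5 i with rfl | rfl | rfl | rfl | ⟨_, _, _, _, e⟩
    · omega
    · omega
    · rcases cases5 j with rfl | rfl | rfl | rfl | ⟨_, _, _, _, e'⟩ <;> try omega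
      rw [g3] at hj hlt
      rw [e'] at hlt hn
      rw [s1]
      exact sep j (by omega) (by omega) (by omega) (by omega) (by omega) (by omega) (by omega)
    · rcases cases5 j with rfl | rfl | rfl | rfl | ⟨_, _, _, _, e'⟩ <;> try omega
      rw [g4] at hj hlt
      rw [e'] at hlt hn
      rw [s2]
      exact sep j (by omega) (by omega) (by omega) (by omega) (by omega) (by omega) (by omega)
    · rcases cases5 j with rfl | rfl | rfl | rfl | ⟨_, _, _, _, e'⟩ <;> try omega
      · rw [e] at hj hlt
        rw [g3] at hlt
        rw [s1]
        exact hr (sep i (by omega) (by omega) (by omega) (by omega) (by omega) (by omega) (by omega))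
      · rw [e] at hj hlt
        rw [g4] at hlt
        rw [s2]
        exact hr (sep i (by omega) (by omega) (by omega) (by omega) (by omega) (by omega) (by omega))
      · rw [e] at hj hlt
        rw [e'] at hlt hn
        exact h.cross i j hij hj hlt hn

end


/-- The word `w` admits a perfect matching in the sense of `IsMatching`. -/
def HasMatching {V : Type} (I : V → V → Prop) (w : List (Op V)) : Prop :=
  ∃ ℓ f, (∀ i < w.length, w[i]? = some (ℓ i)) ∧ IsMatching I w.length ℓ f

section
variable {V : Type} {I : V → V → Prop} {s t : List (Op V)} {a b : Op V}

theorem getElem?_skipTwo (s t : List (Op V)) (a b : Op V) (i : ℕ) :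
    (s ++ [a, b] ++ t)[skipTwo s.length i]? = (s ++ t)[i]? := by
  unfold skipTwo
  split_ifs with h
  · rw [List.append_assoc, List.getElem?_append_left h, List.getElem?_append_left h]
  · rw [List.getElem?_append_right (by simp; omega), List.getElem?_append_right (by omega)]
    congr 1
    simp only [List.length_append, List.length_cons, List.length_nil]
    omega

theorem HasMatching.insert (h : HasMatching I (s ++ t)) (hab : Cancels I a b) :
    HasMatching I (s ++ [a, b] ++ t) := by
  obtain ⟨ℓ, f, hℓ, h⟩ := h
  have hlen : (s ++ [a, b] ++ t).length = (s ++ t).length + 2 := by simp; omega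
  set m : ℕ → Op V := fun i => ((s ++ [a, b] ++ t)[i]?).getD a with hm
  have m0 : m s.length = a := by simp [hm]
  have m1 : m (s.length + 1) = b := by simp [hm]
  obtain ⟨g, hg⟩ := h.insert (p := s.length) (m := m) (by simp) (by rwa [m0, m1]) (by
    intro i hi
    apply Option.some_injective
    rw [← hℓ i hi]
    rw [hm]
    dsimp only
    rw [getElem?_skipTwo, List.getElem?_eq_getElem hi, Option.getD_some])
  refine ⟨m, g, ?_, by rwa [hlen]⟩
  intro i hi
  rw [hm]
  dsimp only
  rw [List.getElem?_eq_getElem hi, Option.getD_some]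

theorem HasMatching.delete (hsym : ∀ a b : V, I a b → I b a)
    (h : HasMatching I (s ++ [a, b] ++ t)) (hab : Cancels I a b) : HasMatching I (s ++ t) := by
  obtain ⟨ℓ, f, hℓ, h⟩ := h
  have hlen : (s ++ [a, b] ++ t).length = (s ++ t).length + 2 := by simp; omega
  have m0 : ℓ s.length = a := by
    have := hℓ s.length (by simp)
    simpa using this.symm
  have m1 : ℓ (s.length + 1) = b := by
    have := hℓ (s.length + 1) (by simp)
    simpa using this.symm
  obtain ⟨f', h', hf'⟩ := h.rematch hsym (p := s.length) (by simp) (by rwa [m0, m1])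
  rw [hlen] at h'
  obtain ⟨g, hg⟩ := h'.delete (by simp) hf'
  refine ⟨_, g, ?_, hg⟩
  intro i hi
  rw [← hℓ _ (by rw [hlen, skipTwo_lt (by simp)]; exact hi)]
  rw [getElem?_skipTwo]

theorem HasMatching.swap (hsym : ∀ a b : V, I a b → I b a)
    (h : HasMatching I (s ++ [a, b] ++ t)) (hab : I a.sym b.sym) :
    HasMatching I (s ++ [b, a] ++ t) := by
  by_cases hs : a.sym = b.sym
  · obtain ⟨o⟩ | ⟨o⟩ := a <;> obtain ⟨q⟩ | ⟨q⟩ := b <;> simp only [Op.sym] at hs hab <;> subst hs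
    · exact h
    · exact (h.delete hsym ⟨o, .inl ⟨rfl, rfl⟩⟩).insert ⟨o, .inr ⟨hab, rfl, rfl⟩⟩
    · exact (h.delete hsym ⟨o, .inr ⟨hab, rfl, rfl⟩⟩).insert ⟨o, .inl ⟨rfl, rfl⟩⟩
    · exact h
  · obtain ⟨ℓ, f, hℓ, h⟩ := h
    have hlen : (s ++ [b, a] ++ t).length = (s ++ [a, b] ++ t).length := by simp
    have m0 : ℓ s.length = a := by
      have := hℓ s.length (by simp)
      simpa using this.symm
    have m1 : ℓ (s.length + 1) = b := by
      have := hℓ (s.length + 1) (by simp)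
      simpa using this.symm
    have hp : s.length + 1 < (s ++ [a, b] ++ t).length := by simp
    refine ⟨_, _, ?_, hlen ▸ h.swap hsym (p := s.length) hp (by rwa [m0, m1]) (by rwa [m0, m1])⟩
    intro i hi
    rw [← hℓ _ (by rw [adjSwap_lt hp, ← hlen]; exact hi)]
    simp only [adjSwap]
    grind

theorem hasMatching_iff_of_mCong (hsym : ∀ a b : V, I a b → I b a) {w v : List (Op V)}
    (h : MCong I w v) : HasMatching I w ↔ HasMatching I v := by
  induction h with
  | rel x y h =>
    cases h with
    | swap s t a b h => exact ⟨fun hm => hm.swap hsym h, fun hm => hm.swap hsym (hsym _ _ h)⟩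
    | cancel s t o =>
      have hc : Cancels I (.pos o) (.neg o) := ⟨o, .inl ⟨rfl, rfl⟩⟩
      exact ⟨fun hm => hm.delete hsym hc, fun hm => hm.insert hc⟩
  | refl => rfl
  | symm _ _ _ ih => exact ih.symm
  | trans _ _ _ _ _ ih1 ih2 => exact ih1.trans ih2

/-- A nonempty word representing the identity has a matching. -/
theorem hasMatching_of_mCong_nil (hsym : ∀ a b : V, I a b → I b a) {w : List (Op V)}
    (hne : w ≠ []) (h : MCong I w []) : HasMatching I w := by
  refine (hasMatching_iff_of_mCong hsym h).2 ⟨fun _ => w.head hne, id, by simp, ?_⟩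
  constructor <;> simp

theorem MCong.append_left (u : List (Op V)) {w v : List (Op V)} (h : MCong I w v) :
    MCong I (u ++ w) (u ++ v) := by
  induction h with
  | rel x y h =>
    refine .rel _ _ ?_
    cases h with
    | swap s t a b h => simpa using MGen.swap (u ++ s) t a b h
    | cancel s t o => simpa using MGen.cancel (I := I) (u ++ s) t o
  | refl => exact .refl _
  | symm _ _ _ ih => exact .symm _ _ ih
  | trans _ _ _ _ _ ih1 ih2 => exact .trans _ _ _ ih1 ih2

theorem MCong.append_right (u : List (Op V)) {w v : List (Op V)} (h : MCong I w v) :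
    MCong I (w ++ u) (v ++ u) := by
  induction h with
  | rel x y h =>
    refine .rel _ _ ?_
    cases h with
    | swap s t a b h => simpa using MGen.swap s (t ++ u) a b h
    | cancel s t o => simpa using MGen.cancel (I := I) s (t ++ u) o
  | refl => exact .refl _
  | symm _ _ _ ih => exact .symm _ _ ih
  | trans _ _ _ _ _ ih1 ih2 => exact .trans _ _ _ ih1 ih2

theorem Cancels.mCong (h : Cancels I a b) : MCong I [a, b] [] := by
  obtain ⟨o, ⟨rfl, rfl⟩ | ⟨ho, rfl, rfl⟩⟩ := h
  · exact .rel _ _ (by simpa using MGen.cancel (I := I) [] [] o)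
  · refine .trans _ [.pos o, .neg o] _ (.rel _ _ ?_) (.rel _ _ ?_)
    · simpa using MGen.swap (I := I) [] [] (.neg o) (.pos o) ho
    · simpa using MGen.cancel (I := I) [] [] o

/-- Nested cancelling pairs represent the identity. -/
theorem mCong_map_append_map_reverse {α : Type*} (ℓ : α → Op V) (f : α → α) :
    ∀ P : List α, (∀ p ∈ P, Cancels I (ℓ p) (ℓ (f p))) →
      MCong I (P.map ℓ ++ (P.reverse.map f).map ℓ) []
  | [], _ => .refl _
  | p :: P, h => by
    have ih := mCong_map_append_map_reverse ℓ f P fun q hq => h q (by simp [hq])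
    have h1 := (ih.append_left [ℓ p]).append_right [ℓ (f p)]
    refine .trans _ _ _ ?_ (h p (by simp)).mCong
    simpa [MCong] using h1

end

theorem reflTransGen_fRStep_move {V : Type} {I : V → V → Prop} (s t : List (List (Op V)))
    (c : List (Op V)) : ∀ u : List (List (Op V)),
      (∀ d ∈ u, ∀ x ∈ c, ∀ y ∈ d, I x.sym y.sym) →
      Relation.ReflTransGen (FRStep I) (s ++ [c] ++ u ++ t) (s ++ u ++ [c] ++ t)
  | [], _ => by simpa using .refl
  | d :: u, h => by
    have ih := reflTransGen_fRStep_move (s ++ [d]) t c u fun e he => h e (by simp [he])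
    have h1 := FRStep.swap s (u ++ t) c d (h d (by simp))
    exact .head (by simpa using h1) (by simpa using ih)

theorem cons_sublist_append_cons {α : Type*} (a : α) (s : List α) {l t : List α}
    (h : l.Sublist t) : (a :: l).Sublist (s ++ a :: t) :=
  (h.cons_cons a).trans (List.sublist_append_right s _)

theorem mem_append_iff_of_nodup {α : Type*} {s u t : List α} {a b c : α}
    (h : (s ++ [a] ++ u ++ [c] ++ t).Nodup) :
    b ∈ s ++ u ++ t ↔ b ∈ s ++ [a] ++ u ++ [c] ++ t ∧ b ≠ a ∧ b ≠ c := by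
  grind

/-- In a sequence of words indexed by the duplicate-free list `L`, if `σ` pairs the indices such
that matched words cancel and crossing pairs are independent, then the sequence is freely
reducible. -/
theorem freelyReducible_of_pairing {V ι : Type} {I : V → V → Prop} (B : ι → List (Op V))
    (σ : ι → ι) (hσ : ∀ a, σ (σ a) = a) (L : List ι) (hnd : L.Nodup)
    (hne : ∀ a ∈ L, σ a ≠ a) (hcl : ∀ a ∈ L, σ a ∈ L)
    (hcancel : ∀ a, [a, σ a].Sublist L → MCong I (B a ++ B (σ a)) [])
    (hcross : ∀ a b, [a, b, σ a, σ b].Sublist L →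
      (∀ x ∈ B a, ∀ y ∈ B b, I x.sym y.sym) ∧ (∀ x ∈ B b, ∀ y ∈ B (σ a), I x.sym y.sym)) :
    FreelyReducible I (L.map B) := by
  induction hn : L.length using Nat.strong_induction_on generalizing L with
  | _ n ih =>
  rcases L.eq_nil_or_concat with rfl | hL
  · exact .refl
  have hex : ∃ m s a u t, L = s ++ [a] ++ u ++ [σ a] ++ t ∧ u.length = m := by
    obtain ⟨L', z, rfl⟩ := hL
    have hz : σ z ∈ L' := by
      have h1 := hcl z (by simp)
      have h2 := hne z (by simp)
      simpa [h2] using h1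
    obtain ⟨s, u, rfl⟩ := List.append_of_mem hz
    exact ⟨_, s, σ z, u, [], by simp [hσ], rfl⟩
  classical
  obtain ⟨s, a, u, t, hL, hm⟩ := Nat.find_spec hex
  have hmin : ∀ s' a' u' t', L = s' ++ [a'] ++ u' ++ [σ a'] ++ t' → u.length ≤ u'.length := by
    intro s' a' u' t' h
    rw [hm]
    exact Nat.find_min' hex ⟨s', a', u', t', h, rfl⟩
  have hind : ∀ b ∈ u, ∀ x ∈ B a, ∀ y ∈ B b, I x.sym y.sym := by
    intro b hb
    obtain ⟨u1, u2, rfl⟩ := List.append_of_mem hb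
    have hbL : σ b ∈ L := hcl b (by simp [hL])
    have h1 := hne b (by simp [hL])
    have hnd' := hnd
    simp only [hL, List.mem_append, List.mem_cons, List.not_mem_nil, or_false] at hbL
    rcases hbL with (((h | h) | (h | h | h)) | h) | h
    · obtain ⟨s1, s2, rfl⟩ := List.append_of_mem h
      have h2 := (hcross (σ b) a ?_).2
      · rwa [hσ] at h2
      · rw [hσ, hL]
        simpa using cons_sublist_append_cons (σ b) s1 (cons_sublist_append_cons a s2
          (cons_sublist_append_cons b u1 (cons_sublist_append_cons (σ a) u2 t.nil_sublist)))
    · have hba : b = σ a := by rw [← h, hσ]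
      rw [hL, hba] at hnd'
      simp [List.nodup_append] at hnd'
    · obtain ⟨v1, v2, rfl⟩ := List.append_of_mem h
      have := hmin (s ++ [a] ++ v1) (σ b) v2 (u2 ++ [σ a] ++ t) (by simp [hL, hσ])
      simp at this
      omega
    · exact absurd h h1
    · obtain ⟨v1, v2, rfl⟩ := List.append_of_mem h
      have := hmin (s ++ [a] ++ u1) b v1 (v2 ++ [σ a] ++ t) (by simp [hL])
      simp at this
      omega
    · have hba : b = a := by rw [← hσ b, h, hσ]
      rw [hL, hba] at hnd'
      simp [List.nodup_append] at hnd'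
    · obtain ⟨t1, t2, rfl⟩ := List.append_of_mem h
      refine (hcross a b ?_).1
      rw [hL]
      simpa using cons_sublist_append_cons a s (cons_sublist_append_cons b u1
        (cons_sublist_append_cons (σ a) u2 (cons_sublist_append_cons (σ b) t1 t2.nil_sublist)))
  have hsub : (s ++ u ++ t).Sublist L := by
    rw [hL]
    exact (((List.sublist_append_left s [a]).append (List.Sublist.refl u)).trans
      (List.sublist_append_left _ _)).append (List.Sublist.refl t)
  have hmem : ∀ b, b ∈ s ++ u ++ t ↔ b ∈ L ∧ b ≠ a ∧ b ≠ σ a := by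
    intro b
    rw [hL] at hnd ⊢
    exact mem_append_iff_of_nodup hnd
  have ha : a ∈ L := by simp [hL]
  have hrest := ih (s ++ u ++ t).length (by rw [← hn, hL]; simp) (s ++ u ++ t)
    (hnd.sublist hsub) (fun b hb => hne b (hsub.subset hb))
    (fun b hb => by
      rw [hmem] at hb ⊢
      refine ⟨hcl b hb.1, fun h => hb.2.2 ?_, fun h => hb.2.1 ?_⟩
      · rw [← h, hσ]
      · rw [← hσ b, h, hσ])
    (fun b hb => hcancel b (hb.trans hsub)) (fun b c hb => hcross b c (hb.trans hsub)) rfl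
  have hmove := reflTransGen_fRStep_move (I := I) (s.map B) ([B (σ a)] ++ t.map B) (B a) (u.map B) (by
    intro d hd
    obtain ⟨b, hb, rfl⟩ := List.mem_map.1 hd
    exact hind b hb)
  have hstep := FRStep.cancel (I := I) (s.map B ++ u.map B) (t.map B) (B a) (B (σ a))
    (hcancel a (by
      rw [hL]
      simp))
  refine .trans (b := s.map B ++ u.map B ++ [B a] ++ ([B (σ a)] ++ t.map B)) ?_
    (.head (b := s.map B ++ u.map B ++ t.map B) ?_ ?_)
  · simpa [hL] using hmove
  · simpa using hstep
  · simpa [FreelyReducible] using hrest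


theorem filter_lt_append_filter_eq {α : Type*} (κ : α → ℕ) (m : ℕ) (L : List α)
    (hs : L.Pairwise fun a b => κ a ≤ κ b) (hlt : ∀ a ∈ L, κ a < m + 1) :
    L.filter (fun a => κ a < m) ++ L.filter (fun a => κ a = m) = L := by
  induction L with
  | nil => rfl
  | cons a L ih =>
    rw [List.pairwise_cons] at hs
    by_cases ha : κ a < m
    · have ih' := ih hs.2 fun b hb => hlt b (by simp [hb])
      simp [ha, ha.ne, ih']
    · have ha' : κ a = m := by have := hlt a (by simp); omega
      have h1 : L.filter (fun a => κ a < m) = [] := by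
        rw [List.filter_eq_nil_iff]
        intro b hb
        have := hs.1 b hb
        simp
        omega
      have h2 : L.filter (fun a => κ a = m) = L := by
        rw [List.filter_eq_self]
        intro b hb
        have h3 := hs.1 b hb
        have h4 := hlt b (by simp [hb])
        simp
        omega
      simp [ha', h1, h2]

/-- A list that is sorted with respect to a key is the concatenation of its fibres. -/
theorem flatten_map_filter_key {α : Type*} (κ : α → ℕ) (m : ℕ) (L : List α)
    (hs : L.Pairwise fun a b => κ a ≤ κ b) (hlt : ∀ a ∈ L, κ a < m) :
    ((List.range m).map fun r => L.filter fun a => κ a = r).flatten = L := by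
  induction m generalizing L with
  | zero =>
    cases L with
    | nil => rfl
    | cons a L => exact absurd (hlt a (by simp)) (by omega)
  | succ m ih =>
    conv_rhs => rw [← filter_lt_append_filter_eq κ m L hs hlt,
      ← ih (L.filter fun a => κ a < m) (hs.filter _) (by simp)]
    simp only [List.range_succ, List.map_append, List.flatten_append, List.map_cons, List.map_nil,
      List.flatten_singleton]
    congr 2
    apply List.map_congr_left
    intro r hr
    rw [List.filter_filter]
    apply List.filter_congr
    intro a _
    have := List.mem_range.1 hr
    simp
    omega

/-- The pieces of a concatenation are the fibres of a monotone function on positions. -/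
theorem exists_monotone_eq_map_filter {α : Type*} (cs : List (List α)) (ℓ : ℕ → α)
    (hℓ : ∀ i < cs.flatten.length, cs.flatten[i]? = some (ℓ i)) :
    ∃ γ : ℕ → ℕ, Monotone γ ∧ (∀ p < cs.flatten.length, γ p < cs.length) ∧
      cs = (List.range cs.length).map fun i =>
        ((List.range cs.flatten.length).filter fun p => γ p = i).map ℓ := by
  induction cs generalizing ℓ with
  | nil => exact ⟨fun _ => 0, fun _ _ _ => le_rfl, by simp, rfl⟩
  | cons c cs ih =>
    have hlen : (c :: cs).flatten.length = c.length + cs.flatten.length := by simp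
    obtain ⟨γ, hmono, hlt, heq⟩ := ih (fun i => ℓ (c.length + i)) (by
      intro i hi
      rw [← hℓ _ (by omega), List.flatten_cons, List.getElem?_append_right (by omega)]
      simp)
    refine ⟨fun p => if p < c.length then 0 else γ (p - c.length) + 1, ?_, ?_, ?_⟩
    · intro p q hpq
      dsimp only
      split_ifs
      · exact le_rfl
      · omega
      · omega
      · exact Nat.succ_le_succ (hmono (by omega))
    · intro p hp
      dsimp only
      split_ifs
      · simp
      · simpa using hlt (p - c.length) (by omega)
    · rw [hlen, List.range_add, List.length_cons, List.range_succ_eq_map, List.map_cons]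
      congr 1
      · rw [List.filter_append, List.filter_eq_self.2 (by simp), List.filter_eq_nil_iff.2 (by simp),
          List.append_nil]
        apply List.ext_getElem?
        intro i
        by_cases hi : i < c.length
        · have := hℓ i (by omega)
          rw [List.flatten_cons, List.getElem?_append_left hi] at this
          rw [this]
          simp [hi]
        · simp [hi]
      · conv_lhs => rw [heq]
        rw [List.map_map]
        apply List.map_congr_left
        intro i _
        simp only [Function.comp_apply, List.filter_append, List.filter_map, List.map_append,
          List.map_map]
        rw [(List.filter_eq_nil_iff (l := List.range c.length)).2 (by simp +contextual)]
        simp [Function.comp_def]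

theorem exists_eq_append_of_pairwise_lt {L : List ℕ} (hL : L.Pairwise (· < ·)) {p q : ℕ}
    (hp : p ∈ L) (hq : q ∈ L) (hpq : p < q) :
    ∃ s u t, L = s ++ [p] ++ u ++ [q] ++ t ∧ ∀ x ∈ u, p < x ∧ x < q := by
  obtain ⟨s, t, rfl⟩ := List.append_of_mem hp
  rw [List.pairwise_append, List.pairwise_cons] at hL
  have hq' : q ∈ t := by
    simp only [List.mem_append, List.mem_cons] at hq
    rcases hq with h | h | h
    · have := hL.2.2 q h p (by simp)
      omega
    · omega
    · exact h
  obtain ⟨u, t, rfl⟩ := List.append_of_mem hq'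
  refine ⟨s, u, t, by simp, fun x hx => ⟨hL.2.1.1 x (by simp [hx]), ?_⟩⟩
  exact (List.pairwise_append.1 hL.2.1.2).2.2 x hx q (by simp)

/-- The order, starting next to the `i`-th place and going backwards cyclically, in which the
places other than `i` are visited. -/
def cyclicRank (k i j : ℕ) : ℕ := if j < i then i - 1 - j else k - 1 + i - j

theorem cyclicRank_lt {k i j : ℕ} (hi : i < k) (hj : j < k) (h : j ≠ i) :
    cyclicRank k i j < k - 1 := by
  unfold cyclicRank; split_ifs <;> omega

theorem cyclicRank_cyclicRank {k i j : ℕ} (hi : i < k) (hj : j < k) :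
    cyclicRank k i (cyclicRank k i j) = j := by
  unfold cyclicRank; split_ifs <;> omega

theorem cyclicRank_of_lt {k i r : ℕ} (hi : i < k) (hr : r < k - 1) :
    cyclicRank k i r < k ∧ cyclicRank k i r ≠ i ∧ cyclicRank k i (cyclicRank k i r) = r := by
  unfold cyclicRank; split_ifs <;> omega

section
variable {V : Type} {I : V → V → Prop} {n k : ℕ} {ℓ : ℕ → Op V} {f γ : ℕ → ℕ}

/-- In irreducible contexts, no two positions of the same context are matched. -/
theorem IsMatching.context_ne (hsym : ∀ a b : V, I a b → I b a) (h : IsMatching I n ℓ f)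
    (hγ : Monotone γ)
    (hirr : ∀ p < n, IrreducibleComp I (((List.range n).filter fun q => γ q = γ p).map ℓ)) :
    ∀ p < n, γ (f p) ≠ γ p := by
  have key : ∀ d p, p < n → f p = p + d → γ (f p) ≠ γ p := by
    intro d
    induction d using Nat.strong_induction_on with
    | _ d ih =>
    intro p hp hd he
    have hfp := h.lt p hp
    have hne := h.ne p hp
    have hpf : p < f p := by omega
    have hu' : ∀ x, p < x → x < f p → I (ℓ p).sym (ℓ x).sym := by
      intro x h1 h2
      have hx : x < n := by omega
      have hγ1 : γ x = γ p := le_antisymm (by rw [← he]; exact hγ h2.le) (hγ h1.le)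
      have hxx := h.inv x hx
      have hxn := h.ne x hx
      have hxp : f x ≠ p := fun e => by rw [e] at hxx; omega
      have hxp' : f x ≠ f p := fun e => by rw [e, h.inv p hp] at hxx; omega
      have hxl := h.lt x hx
      rcases lt_trichotomy (f x) p with h3 | h3 | h3
      · rw [← h.sym_eq hx]
        exact hsym _ _ (h.cross (f x) p h3 (by omega) (by omega) hfp).1
      · exact absurd h3 hxp
      rcases lt_trichotomy (f x) (f p) with h4 | h4 | h4
      · have hγ2 : γ (f x) = γ p := le_antisymm (by rw [← he]; exact hγ h4.le) (hγ h3.le)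
        rcases lt_or_gt_of_ne hxn with h5 | h5
        · exact absurd (by rw [hxx, hγ1, hγ2]) (ih (x - f x) (by omega) (f x) hxl (by omega))
        · exact absurd (by rw [hγ1, hγ2]) (ih (f x - x) (by omega) x hx (by omega))
      · exact absurd h4 hxp'
      · exact (h.cross p x h1 h2 h4 hxl).1
    obtain ⟨s, u, t, hL, hu⟩ := exists_eq_append_of_pairwise_lt
      (List.Pairwise.filter (fun q => decide (γ q = γ p)) (List.pairwise_lt_range (n := n)))
      (p := p) (q := f p) (by simp [hp]) (by simp [hfp, he]) hpf
    refine hirr p hp ?_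
    rw [hL]
    obtain ⟨o, ⟨h1, h2⟩ | ⟨h0, h1, h2⟩⟩ := h.cancels p hp hpf
    · refine ⟨s.map ℓ, u.map ℓ, t.map ℓ, o, .inl ⟨by simp [h1, h2], ?_⟩⟩
      intro a ha
      obtain ⟨x, hx, rfl⟩ := List.mem_map.1 ha
      simpa [h1, Op.sym] using hu' x (hu x hx).1 (hu x hx).2
    · refine ⟨s.map ℓ, u.map ℓ, t.map ℓ, o, .inr ⟨by simp [h1, h2], h0, ?_⟩⟩
      intro a ha
      obtain ⟨x, hx, rfl⟩ := List.mem_map.1 ha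
      simpa [h1, Op.sym] using hu' x (hu x hx).1 (hu x hx).2
  intro p hp
  rcases le_total p (f p) with h1 | h1
  · exact key (f p - p) p hp (by omega)
  · have := key (p - f p) (f p) (h.lt p hp) (by rw [h.inv p hp]; omega)
    rw [h.inv p hp] at this
    exact this.symm

/-- Pairs with ends in a common dependent context do not cross. -/
theorem IsMatching.not_cross (h : IsMatching I n ℓ f)
    (hdep : ∀ p < n, ∀ q < n, γ p = γ q → (ℓ p).sym ≠ (ℓ q).sym → ¬ I (ℓ p).sym (ℓ q).sym)
    {i j : ℕ} (h1 : i < j) (h2 : j < f i) (h3 : f i < f j) (h4 : f j < n) :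
    γ i ≠ γ j ∧ γ i ≠ γ (f j) ∧ γ (f i) ≠ γ j ∧ γ (f i) ≠ γ (f j) := by
  have hI := h.cross i j h1 h2 h3 h4
  have hi : i < n := by omega
  have hj : j < n := by omega
  have si := h.sym_eq hi
  have sj := h.sym_eq hj
  refine ⟨fun e => hdep i hi j hj e hI.2 hI.1, fun e => hdep i hi (f j) h4 e ?_ ?_,
    fun e => hdep (f i) (h.lt i hi) j hj e ?_ ?_,
    fun e => hdep (f i) (h.lt i hi) (f j) h4 e ?_ ?_⟩ <;> simp only [si, sj]
  all_goals first | exact hI.1 | exact hI.2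

/-- Within a context, the partners of later positions are cyclically earlier. -/
theorem IsMatching.partner_order (h : IsMatching I n ℓ f) (hγ : Monotone γ)
    (hdep : ∀ p < n, ∀ q < n, γ p = γ q → (ℓ p).sym ≠ (ℓ q).sym → ¬ I (ℓ p).sym (ℓ q).sym)
    (hne : ∀ p < n, γ (f p) ≠ γ p) {p q : ℕ} (hpq : p < q) (hq : q < n) (e : γ p = γ q) :
    (f p < p ∧ q < f q) ∨ (f q < f p ∧ ((f p < p ∧ f q < q) ∨ (p < f p ∧ q < f q))) := by
  have hp : p < n := by omega
  have p1 := h.inv p hp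
  have p2 := h.ne p hp
  have p3 := h.lt p hp
  have q1 := h.inv q hq
  have q2 := h.ne q hq
  have q3 := h.lt q hq
  have hpq' : f p ≠ f q := fun h => by rw [h, q1] at p1; omega
  have hpq1 : f p ≠ q := fun h => hne p hp (by rw [h, e])
  have hpq2 : f q ≠ p := fun h => hne q hq (by rw [h, e])
  rcases lt_or_gt_of_ne p2 with a1 | a1 <;> rcases lt_or_gt_of_ne q2 with a2 | a2
  · by_cases c : f p < f q
    · have b2 : f q < p := by
        by_contra hb
        have c1 := hγ (show p ≤ f q by omega)
        have c2 := hγ a2.le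
        exact hne q hq (by omega)
      have := h.not_cross hdep (i := f p) (j := f q) c (by omega) (by omega) (by omega)
      rw [p1, q1] at this
      exact absurd e this.2.2.2
    · omega
  · omega
  · have b2 : f q < p := by
      by_contra hb
      have c1 := hγ (show p ≤ f q by omega)
      have c2 := hγ a2.le
      exact hne q hq (by omega)
    have b1 : q < f p := by
      by_contra hb
      have c1 := hγ (show f p ≤ q by omega)
      have c2 := hγ a1.le
      exact hne p hp (by omega)
    have := h.not_cross hdep (i := f q) (j := p) b2 (by omega) (by omega) (by omega)
    rw [q1] at this
    exact absurd e.symm this.2.2.1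
  · have b1 : q < f p := by
      by_contra hb
      have c1 := hγ (show f p ≤ q by omega)
      have c2 := hγ a1.le
      exact hne p hp (by omega)
    by_cases c : f p < f q
    · exact absurd e (h.not_cross hdep hpq b1 c q3).1
    · omega

theorem IsMatching.cyclicRank_le (h : IsMatching I n ℓ f) (hγ : Monotone γ)
    (hk : ∀ p < n, γ p < k)
    (hdep : ∀ p < n, ∀ q < n, γ p = γ q → (ℓ p).sym ≠ (ℓ q).sym → ¬ I (ℓ p).sym (ℓ q).sym)
    (hne : ∀ p < n, γ (f p) ≠ γ p) {p q : ℕ} (hpq : p < q) (hq : q < n) (e : γ p = γ q) :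
    cyclicRank k (γ p) (γ (f p)) ≤ cyclicRank k (γ q) (γ (f q)) := by
  have hp : p < n := by omega
  have h1 := hne p hp
  have h2 := hne q hq
  have k1 := hk p hp
  have k2 := hk _ (h.lt p hp)
  have k3 := hk _ (h.lt q hq)
  unfold cyclicRank
  rcases h.partner_order hγ hdep hne hpq hq e with ⟨a1, a2⟩ | ⟨a0, ⟨a1, a2⟩ | ⟨a1, a2⟩⟩
  all_goals
    have c1 := hγ a1.le
    have c2 := hγ a2.le
  · split_ifs <;> omega
  · have c0 := hγ a0.le
    split_ifs <;> omega
  · have c0 := hγ a0.le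
    split_ifs <;> omega

end


section
variable {V : Type} {I : V → V → Prop} {n k : ℕ} {ℓ : ℕ → Op V} {f γ : ℕ → ℕ}

/-- The positions in context `a.1` that are matched with a position in context `a.2`. -/
def blockPositions (n : ℕ) (f γ : ℕ → ℕ) (a : ℕ × ℕ) : List ℕ :=
  (List.range n).filter fun p => γ p = a.1 ∧ γ (f p) = a.2

theorem mem_blockPositions {p : ℕ} {a : ℕ × ℕ} :
    p ∈ blockPositions n f γ a ↔ p < n ∧ γ p = a.1 ∧ γ (f p) = a.2 := by
  simp [blockPositions]

/-- The blocks of `k` contexts, in their order in the word. -/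
def blockIndices (k : ℕ) : List (ℕ × ℕ) :=
  ((List.range k).map fun i => (List.range (k - 1)).map fun r => (i, cyclicRank k i r)).flatten

theorem mem_blockIndices {a : ℕ × ℕ} :
    a ∈ blockIndices k ↔ a.1 < k ∧ a.2 < k ∧ a.2 ≠ a.1 := by
  obtain ⟨i, j⟩ := a
  simp only [blockIndices, List.mem_flatten, List.mem_map, List.mem_range]
  constructor
  · rintro ⟨_, ⟨i', hi', rfl⟩, h⟩
    obtain ⟨r, hr, h⟩ := List.mem_map.1 h
    obtain ⟨rfl, rfl⟩ := Prod.mk.inj h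
    have := cyclicRank_of_lt hi' (List.mem_range.1 hr)
    exact ⟨hi', this.1, this.2.1⟩
  · rintro ⟨hi, hj, hij⟩
    exact ⟨_, ⟨i, hi, rfl⟩, List.mem_map.2 ⟨cyclicRank k i j,
      List.mem_range.2 (cyclicRank_lt hi hj hij), by rw [cyclicRank_cyclicRank hi hj]⟩⟩

/-- The order of the blocks in the word. -/
def BlockLT (k : ℕ) (a b : ℕ × ℕ) : Prop :=
  a.1 < b.1 ∨ (a.1 = b.1 ∧ cyclicRank k a.1 a.2 < cyclicRank k b.1 b.2)

theorem pairwise_blockIndices : (blockIndices k).Pairwise (BlockLT k) := by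
  rw [blockIndices, List.pairwise_flatten]
  constructor
  · intro l hl
    obtain ⟨i, hi, rfl⟩ := List.mem_map.1 hl
    rw [List.pairwise_map]
    refine List.pairwise_lt_range.imp_of_mem ?_
    intro r s hr hs hrs
    have hi' := List.mem_range.1 hi
    refine .inr ⟨rfl, ?_⟩
    rwa [(cyclicRank_of_lt hi' (List.mem_range.1 hr)).2.2,
      (cyclicRank_of_lt hi' (List.mem_range.1 hs)).2.2]
  · rw [List.pairwise_map]
    refine List.pairwise_lt_range.imp ?_
    intro i j hij a ha b hb
    obtain ⟨r, _, rfl⟩ := List.mem_map.1 ha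
    obtain ⟨s, _, rfl⟩ := List.mem_map.1 hb
    exact .inl hij

theorem nodup_blockIndices : (blockIndices k).Nodup := by
  refine pairwise_blockIndices.imp ?_
  rintro a b (h | ⟨_, h⟩) rfl <;> omega

/-- A matching of a word whose contexts are given by `γ`, such that contexts are dependent and not
matched with themselves, induces a free reduction of the blocks. -/
theorem IsMatching.freelyReducible_blocks (hsym : ∀ a b : V, I a b → I b a)
    (h : IsMatching I n ℓ f) (hγ : Monotone γ) (hk : ∀ p < n, γ p < k)
    (hdep : ∀ p < n, ∀ q < n, γ p = γ q → (ℓ p).sym ≠ (ℓ q).sym → ¬ I (ℓ p).sym (ℓ q).sym)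
    (hne : ∀ p < n, γ (f p) ≠ γ p) :
    FreelyReducible I ((blockIndices k).map fun a => (blockPositions n f γ a).map ℓ) := by
  have hlt : ∀ {a b p q}, BlockLT k a b → p ∈ blockPositions n f γ a →
      q ∈ blockPositions n f γ b → p < q := by
    rintro ⟨i, i'⟩ ⟨j, j'⟩ p q hab hp hq
    obtain ⟨hp', rfl, rfl⟩ := mem_blockPositions.1 hp
    obtain ⟨hq, rfl, rfl⟩ := mem_blockPositions.1 hq
    by_contra hc
    have h1 := hγ (show q ≤ p by omega)
    rcases hab with h2 | ⟨h2, h3⟩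
    · simp only at h2
      omega
    · simp only at h2 h3
      rcases (show q ≤ p by omega).eq_or_lt with rfl | h4
      · omega
      · have := h.cyclicRank_le hγ hk hdep hne h4 hp' h2.symm
        omega
  have hf : ∀ {a p}, p ∈ blockPositions n f γ a → f p ∈ blockPositions n f γ a.swap := by
    intro a p hp
    obtain ⟨hp, h1, h2⟩ := mem_blockPositions.1 hp
    exact mem_blockPositions.2 ⟨h.lt p hp, h2, by rw [h.inv p hp]; exact h1⟩
  refine freelyReducible_of_pairing _ Prod.swap Prod.swap_swap _ nodup_blockIndices ?_ ?_ ?_ ?_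
  · rintro ⟨i, j⟩ ha he
    exact (mem_blockIndices.1 ha).2.2 (Prod.mk.inj he).1
  · intro a ha
    obtain ⟨h1, h2, h3⟩ := mem_blockIndices.1 ha
    exact mem_blockIndices.2 ⟨h2, h1, h3.symm⟩
  · intro a ha
    have hR : BlockLT k a a.swap := by
      simpa using pairwise_blockIndices.sublist ha
    have hrev : blockPositions n f γ a.swap = (blockPositions n f γ a).reverse.map f := by
      refine List.Pairwise.eq_of_mem_iff (r := (· < ·)) (List.pairwise_lt_range.filter _) ?_ ?_
      · rw [List.pairwise_map, List.pairwise_reverse]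
        refine (List.pairwise_lt_range.filter _).imp_of_mem ?_
        intro p q hp hq hpq
        obtain ⟨hp', p1, p2⟩ := mem_blockPositions.1 hp
        obtain ⟨hq', q1, q2⟩ := mem_blockPositions.1 hq
        have l1 := hlt hR hp (hf hp)
        rcases h.partner_order hγ hdep hne hpq hq' (p1.trans q1.symm) with h1 | h1 <;> omega
      · intro q
        simp only [List.mem_map, List.mem_reverse]
        constructor
        · intro hq
          exact ⟨f q, by simpa using hf hq, h.inv q (mem_blockPositions.1 hq).1⟩
        · rintro ⟨p, hp, rfl⟩
          exact hf hp
    rw [hrev]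
    exact mCong_map_append_map_reverse ℓ f _ fun p hp =>
      h.cancels p (mem_blockPositions.1 hp).1 (hlt hR hp (hf hp))
  · intro a b hab
    have hR := pairwise_blockIndices.sublist hab
    simp only [List.pairwise_cons, List.mem_cons, List.not_mem_nil, or_false, forall_eq_or_imp,
      forall_eq] at hR
    have hI : ∀ p ∈ blockPositions n f γ a, ∀ q ∈ blockPositions n f γ b,
        I (ℓ p).sym (ℓ q).sym := fun p hp q hq =>
      (h.cross p q (hlt hR.1.1 hp hq) (hlt hR.2.1.1 hq (hf hp)) (hlt hR.2.2.1 (hf hp) (hf hq))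
        (mem_blockPositions.1 (hf hq)).1).1
    constructor
    · intro x hx y hy
      obtain ⟨p, hp, rfl⟩ := List.mem_map.1 hx
      obtain ⟨q, hq, rfl⟩ := List.mem_map.1 hy
      exact hI p hp q hq
    · intro x hx y hy
      obtain ⟨p, hp, rfl⟩ := List.mem_map.1 hx
      obtain ⟨q, hq, rfl⟩ := List.mem_map.1 hy
      have hq' : f q ∈ blockPositions n f γ a := by simpa using hf hq
      rw [← h.sym_eq (mem_blockPositions.1 hq).1]
      exact hsym _ _ (hI _ hq' p hp)

end

/-- **Block decomposition** (Theorem `Lemma:Crazy`).  Let `w` be a nonempty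
computation with `⟦w⟧ = 1` whose context decomposition `ctxs = w₁,…,w_k` consists of
irreducible contexts.  Then every context `wᵢ` factors into `mᵢ ≤ k - 1` blocks such
that the combined sequence of all blocks is freely reducible; in particular the total
number of pieces is at most `k²`. -/
theorem block_decomposition {V : Type} (I : V → V → Prop)
    (hsym : ∀ a b : V, I a b → I b a)
    (w : List (Op V)) (hne : w ≠ []) (hone : MCong I w [])
    (ctxs : List (List (Op V))) (hctx : IsContextDecomp I w ctxs)
    (hirr : ∀ c ∈ ctxs, IrreducibleComp I c) :
    ∃ blockss : List (List (List (Op V))),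
      List.Forall₂ (fun bs c => bs.flatten = c ∧ bs.length ≤ ctxs.length - 1) blockss ctxs ∧
      FreelyReducible I blockss.flatten ∧
      blockss.flatten.length ≤ ctxs.length ^ 2 := by
  obtain ⟨ℓ, f, hℓ, h⟩ := hasMatching_of_mCong_nil hsym hne hone
  obtain ⟨hflat, -, hctx, -⟩ := hctx
  subst hflat
  obtain ⟨γ, hγ, hk, heq⟩ := exists_monotone_eq_map_filter ctxs ℓ hℓ
  set n := ctxs.flatten.length
  set k := ctxs.length
  have hmem : ∀ p < n, ((List.range n).filter fun q => γ q = γ p).map ℓ ∈ ctxs := by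
    intro p hp
    rw [heq]
    exact List.mem_map.2 ⟨γ p, List.mem_range.2 (hk p hp), rfl⟩
  have hdep : ∀ p < n, ∀ q < n, γ p = γ q → (ℓ p).sym ≠ (ℓ q).sym →
      ¬ I (ℓ p).sym (ℓ q).sym := by
    intro p hp q hq e
    exact (hctx _ (hmem p hp)).2 (ℓ p) (List.mem_map.2 ⟨p, by simp [hp], rfl⟩)
      (ℓ q) (List.mem_map.2 ⟨q, by simp [hq, e], rfl⟩)
  have hctxne := h.context_ne hsym hγ fun p hp => hirr _ (hmem p hp)
  refine ⟨(List.range k).map fun i => (List.range (k - 1)).map fun r =>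
    (blockPositions n f γ (i, cyclicRank k i r)).map ℓ, ?_, ?_, ?_⟩
  · rw [heq, List.forall₂_map_left_iff, List.forall₂_map_right_iff, List.forall₂_same]
    intro i hi
    have hi' := List.mem_range.1 hi
    refine ⟨?_, by simp⟩
    have hs : ((List.range n).filter fun p => γ p = i).Pairwise fun p q =>
        cyclicRank k i (γ (f p)) ≤ cyclicRank k i (γ (f q)) := by
      refine (List.pairwise_lt_range.filter _).imp_of_mem ?_
      intro p q hp hq hpq
      simp only [List.mem_filter, List.mem_range, decide_eq_true_eq] at hp hq
      have := h.cyclicRank_le hγ hk hdep hctxne hpq hq.1 (hp.2.trans hq.2.symm)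
      rwa [hp.2, hq.2] at this
    have hlt : ∀ p ∈ (List.range n).filter fun p => γ p = i,
        cyclicRank k i (γ (f p)) < k - 1 := by
      intro p hp
      simp only [List.mem_filter, List.mem_range, decide_eq_true_eq] at hp
      exact cyclicRank_lt hi' (hk _ (h.lt p hp.1)) (hp.2 ▸ hctxne p hp.1)
    rw [← flatten_map_filter_key _ _ _ hs hlt, List.map_flatten, List.map_map]
    congr 1
    apply List.map_congr_left
    intro r hr
    have hr' := cyclicRank_of_lt hi' (List.mem_range.1 hr)
    rw [Function.comp_apply, List.filter_filter, blockPositions]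
    congr 1
    apply List.filter_congr
    intro p hp
    have hp' := hk _ (h.lt p (List.mem_range.1 hp))
    have hiff : γ (f p) = cyclicRank k i r ↔ cyclicRank k i (γ (f p)) = r :=
      ⟨fun e => by rw [e, hr'.2.2], fun e => by rw [← e, cyclicRank_cyclicRank hi' hp']⟩
    simp only [hiff]
    simp [Bool.and_comm]
  · have := h.freelyReducible_blocks hsym hγ hk hdep hctxne
    simpa only [blockIndices, List.map_flatten, List.map_map, Function.comp_def] using this
  · simp only [List.length_flatten, List.map_map, Function.comp_def, List.length_map,
      List.length_range, List.map_const', List.sum_replicate, smul_eq_mul, pow_two]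
    exact Nat.mul_le_mul_left _ (Nat.sub_le _ _)
end

section
/- Let w be a dependent computation. Then w can be transformed into an irreducible computation by finitely many applications of the following two deletion rules: delete an adjacent pair of letters o⁺ o⁻ (in this order); and delete an adjacent pair of letters o⁻ o⁺ provided (o,o) ∈ I. In particular, there exists an irreducible computation v with w ≅ v obtained from w by these deletions alone. -/
/-- One deletion step: delete an adjacent pair `o⁺ o⁻`, or an adjacent pair
`o⁻ o⁺` provided `(o,o) ∈ I`. -/
inductive DelStep {V : Type} (I : V → V → Prop) : List (Op V) → List (Op V) → Prop
  | del1 (s t : List (Op V)) (o : V) :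
      DelStep I (s ++ [Op.pos o, Op.neg o] ++ t) (s ++ t)
  | del2 (s t : List (Op V)) (o : V) (h : I o o) :
      DelStep I (s ++ [Op.neg o, Op.pos o] ++ t) (s ++ t)

theorem DelStep.length_lt {V : Type} {I : V → V → Prop} {w v : List (Op V)}
    (h : DelStep I w v) : v.length < w.length := by
  cases h <;> simp

theorem DelStep.subset {V : Type} {I : V → V → Prop} {w v : List (Op V)}
    (h : DelStep I w v) : v ⊆ w := by
  cases h <;> intro a ha <;> simp at ha ⊢ <;> tauto

theorem DelStep.mCong {V : Type} {I : V → V → Prop} {w v : List (Op V)}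
    (h : DelStep I w v) : MCong I w v := by
  cases h with
  | del1 s t o => exact .rel _ _ (.cancel s t o)
  | del2 s t o h =>
    exact .trans _ _ _ (.rel _ _ (.swap s t (.neg o) (.pos o) h)) (.rel _ _ (.cancel s t o))

theorem DependentWord.mono {V : Type} {I : V → V → Prop} {w v : List (Op V)}
    (hw : DependentWord I w) (h : v ⊆ w) : DependentWord I v :=
  fun a ha b hb => hw a (h ha) b (h hb)

/-- A block of operations on the single symbol `o` that begins with `o⁺` and ends with `o⁻`
contains an adjacent pair `o⁺ o⁻`. -/
theorem exists_delStep_of_pos_neg {V : Type} (I : V → V → Prop) (o : V)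
    (s u t : List (Op V)) (hu : ∀ a ∈ u, Op.sym a = o) :
    ∃ v, DelStep I (s ++ [Op.pos o] ++ u ++ [Op.neg o] ++ t) v := by
  induction u generalizing s with
  | nil => exact ⟨_, by simpa using DelStep.del1 (I := I) s t o⟩
  | cons a u ih =>
    obtain ⟨rfl, hu⟩ : Op.sym a = o ∧ ∀ b ∈ u, Op.sym b = o := by simpa using hu
    cases a with
    | pos p =>
      obtain ⟨v, hv⟩ := ih (s ++ [.pos p]) hu
      refine ⟨v, ?_⟩
      convert hv using 1
      simp [Op.sym]
    | neg p =>
      refine ⟨s ++ (u ++ [.neg p] ++ t), ?_⟩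
      convert DelStep.del1 (I := I) s (u ++ [.neg p] ++ t) p using 1
      simp [Op.sym]

/-- A block of operations on the single symbol `o`, with `I o o`, that begins with `o⁻` and ends
with `o⁺` contains an adjacent pair `o⁻ o⁺`. -/
theorem exists_delStep_of_neg_pos {V : Type} {I : V → V → Prop} {o : V} (ho : I o o)
    (s u t : List (Op V)) (hu : ∀ a ∈ u, Op.sym a = o) :
    ∃ v, DelStep I (s ++ [Op.neg o] ++ u ++ [Op.pos o] ++ t) v := by
  induction u generalizing s with
  | nil => exact ⟨_, by simpa using DelStep.del2 s t o ho⟩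
  | cons a u ih =>
    obtain ⟨rfl, hu⟩ : Op.sym a = o ∧ ∀ b ∈ u, Op.sym b = o := by simpa using hu
    cases a with
    | neg p =>
      obtain ⟨v, hv⟩ := ih (s ++ [.neg p]) hu
      refine ⟨v, ?_⟩
      convert hv using 1
      simp [Op.sym]
    | pos p =>
      refine ⟨s ++ (u ++ [.pos p] ++ t), ?_⟩
      convert DelStep.del2 s (u ++ [.pos p] ++ t) p ho using 1
      simp [Op.sym]

theorem DependentWord.exists_delStep {V : Type} {I : V → V → Prop} {w : List (Op V)}
    (hw : DependentWord I w) (h : ¬ IrreducibleComp I w) : ∃ v, DelStep I w v := by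
  obtain ⟨s, u, t, o, ⟨rfl, hu⟩ | ⟨rfl, ho, hu⟩⟩ := not_not.mp h
  · refine exists_delStep_of_pos_neg I o s u t fun a ha => ?_
    by_contra hne
    exact hw (.pos o) (by simp) a (by simp [ha]) (Ne.symm hne) (hu a ha)
  · refine exists_delStep_of_neg_pos ho s u t fun a ha => ?_
    by_contra hne
    exact hw (.neg o) (by simp) a (by simp [ha]) (Ne.symm hne) (hu a ha)

/-- Every dependent computation can be turned into an irreducible computation by
finitely many applications of the two deletion rules; in particular there is an
irreducible `v` with `w ≅ v` obtained from `w` by these deletions alone. -/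
theorem dependent_deletions_to_irreducible {V : Type} (I : V → V → Prop)
    (hsym : ∀ a b : V, I a b → I b a)
    (w : List (Op V)) (hdep : DependentWord I w) :
    ∃ v : List (Op V), Relation.ReflTransGen (DelStep I) w v ∧
      IrreducibleComp I v ∧ MCong I w v := by
  induction hn : w.length using Nat.strong_induction_on generalizing w with
  | _ n ih =>
    subst hn
    by_cases hirr : IrreducibleComp I w
    · exact ⟨w, .refl, hirr, .refl w⟩
    · obtain ⟨v, hv⟩ := hdep.exists_delStep hirr
      obtain ⟨x, hvx, hx, hcong⟩ := ih _ hv.length_lt v (hdep.mono hv.subset) rfl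
      exact ⟨x, .head hv hvx, hx, .trans _ _ _ hv.mCong hcong⟩
end

section
/- If w is an irreducible computation with ⟦w⟧ = 1, then w is the empty word. Equivalently, every nonempty computation w with ⟦w⟧ = 1 is not irreducible. -/
/-- Two operations on a common symbol that cancel: `o⁺, o⁻`, or `o⁻, o⁺` when `(o,o) ∈ I`. -/
def Complementary {V : Type} (I : V → V → Prop) (x y : Op V) : Prop :=
  ∃ o, (x = Op.pos o ∧ y = Op.neg o) ∨ (x = Op.neg o ∧ y = Op.pos o ∧ I o o)

/-- `Contracts I w v`: the computation `v` arises from `w` by deleting a complementary pair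
of operations that are independent of everything between them. -/
inductive Contracts {V : Type} (I : V → V → Prop) : List (Op V) → List (Op V) → Prop
  | mk (s u t : List (Op V)) (x y : Op V) (hxy : Complementary I x y)
      (hu : ∀ a ∈ u, I x.sym a.sym) : Contracts I (s ++ x :: (u ++ y :: t)) (s ++ (u ++ t))

/-- Directed reduction by swaps and cancellations. -/
abbrev Reduces {V : Type} (I : V → V → Prop) : List (Op V) → List (Op V) → Prop :=
  Relation.ReflTransGen (MGen I)

section GraphMonoid

variable {V : Type} {I : V → V → Prop}

theorem Complementary.sym_eq {x y : Op V} (h : Complementary I x y) : x.sym = y.sym := by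
  obtain ⟨o, ⟨rfl, rfl⟩ | ⟨rfl, rfl, -⟩⟩ := h <;> rfl

theorem Complementary.swap {x y : Op V} (h : Complementary I x y) (hI : I x.sym y.sym) :
    Complementary I y x := by
  obtain ⟨o, ⟨rfl, rfl⟩ | ⟨rfl, rfl, -⟩⟩ := h
  · exact ⟨o, Or.inr ⟨rfl, rfl, hI⟩⟩
  · exact ⟨o, Or.inl ⟨rfl, rfl⟩⟩

theorem reduces_swap (s t : List (Op V)) (a b : Op V) (h : I a.sym b.sym) :
    Reduces I (s ++ a :: b :: t) (s ++ b :: a :: t) := by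
  simpa using Relation.ReflTransGen.single (MGen.swap s t a b h)

theorem reduces_cancel (s t : List (Op V)) (o : V) :
    Reduces I (s ++ Op.pos o :: Op.neg o :: t) (s ++ t) := by
  simpa using Relation.ReflTransGen.single (MGen.cancel (I := I) s t o)

theorem reduces_move_right (s u t : List (Op V)) (x : Op V) (hu : ∀ a ∈ u, I x.sym a.sym) :
    Reduces I (s ++ x :: (u ++ t)) (s ++ (u ++ x :: t)) := by
  induction u generalizing s with
  | nil => exact .refl
  | cons c u ih =>
    simp only [List.mem_cons, forall_eq_or_imp] at hu
    simpa using (reduces_swap s (u ++ t) x c hu.1).trans (by simpa using ih (s ++ [c]) hu.2)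

theorem reduces_move_left (hsym : ∀ a b : V, I a b → I b a) (s u t : List (Op V)) (x : Op V)
    (hu : ∀ a ∈ u, I x.sym a.sym) :
    Reduces I (s ++ (u ++ x :: t)) (s ++ x :: (u ++ t)) := by
  induction u generalizing s with
  | nil => exact .refl
  | cons c u ih =>
    simp only [List.mem_cons, forall_eq_or_imp] at hu
    have h := ih (s ++ [c]) hu.2
    simp only [List.append_assoc, List.cons_append, List.nil_append] at h ⊢
    exact h.trans (reduces_swap s (u ++ t) c x (hsym _ _ hu.1))

/-- The possible positions of an adjacent pair `p, q` relative to a marked letter `x`. -/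
theorem adjacent_pair_cases {α : Type} {s t s' r : List α} {p q x : α}
    (h : s ++ p :: q :: t = s' ++ x :: r) :
    (∃ m, s' = s ++ p :: q :: m ∧ t = m ++ x :: r) ∨ (s' = s ++ [p] ∧ x = q ∧ t = r) ∨
      (s' = s ∧ x = p ∧ r = q :: t) ∨ ∃ m, s = s' ++ x :: m ∧ r = m ++ p :: q :: t := by
  rw [List.append_eq_append_iff] at h
  rcases h with ⟨m, rfl, h⟩ | ⟨m, rfl, h⟩
  · match m with
    | [] => simp_all
    | [_] => simp_all
    | _ :: _ :: m => simp_all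
  · match m with
    | [] => simp_all
    | _ :: m => simp_all

theorem Contracts.exists_of_swap (hsym : ∀ a b : V, I a b → I b a) {s t v : List (Op V)}
    {p q : Op V} (hpq : I p.sym q.sym) (h : Contracts I (s ++ p :: q :: t) v) :
    ∃ v', Contracts I (s ++ q :: p :: t) v' ∧ Reduces I v v' := by
  generalize hw : s ++ p :: q :: t = w at h
  obtain ⟨s', u, t', x, y, hxy, hu⟩ := h
  rcases adjacent_pair_cases hw with
    ⟨m, rfl, rfl⟩ | ⟨rfl, rfl, rfl⟩ | ⟨rfl, rfl, h⟩ | ⟨m, rfl, h⟩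
  · refine ⟨s ++ q :: p :: (m ++ (u ++ t')), ?_, ?_⟩
    · simpa using Contracts.mk (I := I) (s ++ q :: p :: m) u t' x y hxy hu
    · simpa using reduces_swap (I := I) s (m ++ (u ++ t')) p q hpq
  · refine ⟨s ++ (p :: u ++ t'), ?_, ?_⟩
    · simpa using Contracts.mk (I := I) s (p :: u) t' x y hxy (by simpa using ⟨hsym _ _ hpq, hu⟩)
    · simpa using .refl
  · match u with
    | [] =>
      obtain ⟨rfl, rfl⟩ : y = q ∧ t' = t := by simpa using h
      exact ⟨_, Contracts.mk s' [] t' y x (hxy.swap hpq) (by simp), .refl⟩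
    | c :: u =>
      obtain ⟨rfl, rfl⟩ : c = q ∧ u ++ y :: t' = t := by simpa using h
      refine ⟨s' ++ c :: (u ++ t'), ?_, .refl⟩
      simpa using Contracts.mk (I := I) (s' ++ [c]) u t' x y hxy (fun a ha => hu a (by simp [ha]))
  · rcases adjacent_pair_cases h.symm with
      ⟨n, rfl, rfl⟩ | ⟨rfl, rfl, rfl⟩ | ⟨rfl, rfl, rfl⟩ | ⟨n, rfl, rfl⟩
    · refine ⟨s' ++ ((m ++ q :: p :: n) ++ t'), ?_, ?_⟩
      · simpa using Contracts.mk (I := I) s' (m ++ q :: p :: n) t' x y hxy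
          (fun a ha => hu a (by simp at ha ⊢; tauto))
      · simpa using reduces_swap (I := I) (s' ++ m) (n ++ t') p q hpq
    · refine ⟨s' ++ (m ++ p :: t), ?_, by simpa using .refl⟩
      simpa using Contracts.mk (I := I) s' m (p :: t) x y hxy (fun a ha => hu a (by simp [ha]))
    · refine ⟨s' ++ ((u ++ [q]) ++ t), ?_, by simpa using .refl⟩
      simpa using Contracts.mk (I := I) s' (u ++ [q]) t x y hxy (by
        intro a ha
        simp only [List.mem_append, List.mem_singleton] at ha
        rcases ha with ha | rfl
        · exact hu a ha
        · rwa [hxy.sym_eq])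
    · refine ⟨s' ++ (u ++ (n ++ q :: p :: t)), ?_, ?_⟩
      · simpa using Contracts.mk (I := I) s' u (n ++ q :: p :: t) x y hxy hu
      · simpa using reduces_swap (I := I) (s' ++ (u ++ n)) t p q hpq

theorem Contracts.of_cancel (hsym : ∀ a b : V, I a b → I b a) {s t v : List (Op V)} {o : V}
    (h : Contracts I (s ++ Op.pos o :: Op.neg o :: t) v) :
    Reduces I v (s ++ t) ∨ ∃ v', Contracts I (s ++ t) v' ∧ Reduces I v v' := by
  generalize hw : s ++ Op.pos o :: Op.neg o :: t = w at h
  obtain ⟨s', u, t', x, y, hxy, hu⟩ := h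
  rcases adjacent_pair_cases hw with
    ⟨m, rfl, rfl⟩ | ⟨rfl, rfl, rfl⟩ | ⟨rfl, rfl, h⟩ | ⟨m, rfl, h⟩
  · refine .inr ⟨s ++ (m ++ (u ++ t')), ?_, ?_⟩
    · simpa using Contracts.mk (I := I) (s ++ m) u t' x y hxy hu
    · simpa using reduces_cancel (I := I) s (m ++ (u ++ t')) o
  · obtain ⟨_, ⟨h, -⟩ | ⟨h, rfl, -⟩⟩ := hxy
    · cases h
    · cases h
      left
      simpa using reduces_move_right s u t' (Op.pos o) hu
  · match u with
    | [] =>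
      obtain ⟨rfl, rfl⟩ : y = Op.neg o ∧ t' = t := by simpa using h
      exact .inl .refl
    | c :: u =>
      obtain ⟨rfl, rfl⟩ : c = Op.neg o ∧ u ++ y :: t' = t := by simpa using h
      obtain ⟨_, ⟨ho, rfl⟩ | ⟨ho, -⟩⟩ := hxy
      · cases ho
        left
        simpa using reduces_move_right s' u t' (Op.neg o) (fun a ha => hu a (by simp [ha]))
      · cases ho
  · rcases adjacent_pair_cases h.symm with
      ⟨n, rfl, rfl⟩ | ⟨rfl, rfl, rfl⟩ | ⟨rfl, rfl, rfl⟩ | ⟨n, rfl, rfl⟩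
    · refine .inr ⟨s' ++ ((m ++ n) ++ t'), ?_, ?_⟩
      · simpa using Contracts.mk (I := I) s' (m ++ n) t' x y hxy
          (fun a ha => hu a (by simp at ha ⊢; tauto))
      · simpa using reduces_cancel (I := I) (s' ++ m) (n ++ t') o
    · obtain ⟨_, ⟨rfl, h⟩ | ⟨-, h, -⟩⟩ := hxy
      · cases h
        left
        simpa using reduces_move_left hsym s' m t (Op.pos o) (fun a ha => hu a (by simp [ha]))
      · cases h
    · obtain ⟨_, ⟨-, h⟩ | ⟨rfl, h, -⟩⟩ := hxy
      · cases h
      · cases h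
        left
        simpa using reduces_move_left hsym s' u t (Op.neg o) hu
    · refine .inr ⟨s' ++ (u ++ (n ++ t)), ?_, ?_⟩
      · simpa using Contracts.mk (I := I) s' u (n ++ t) x y hxy hu
      · simpa using reduces_cancel (I := I) (s' ++ (u ++ n)) t o

theorem Contracts.reduces_nil (hsym : ∀ a b : V, I a b → I b a) {w v : List (Op V)}
    (hw : Reduces I w []) (h : Contracts I w v) : Reduces I v [] := by
  induction hw using Relation.ReflTransGen.head_induction_on generalizing v with
  | refl =>
    generalize hn : ([] : List (Op V)) = n at h
    obtain ⟨s, u, t, x, y, -, -⟩ := h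
    simp at hn
  | head hstep hrest ih =>
    rcases hstep with ⟨s, t, a, b, hab⟩ | ⟨s, t, o⟩
    · obtain ⟨v', hv', hr⟩ := exists_of_swap (s := s) (t := t) hsym hab (by simpa using h)
      exact hr.trans (ih (by simpa using hv'))
    · rcases of_cancel (s := s) (t := t) (o := o) hsym (by simpa using h) with hr | ⟨v', hv', hr⟩
      · exact hr.trans hrest
      · exact hr.trans (ih hv')

theorem MCong.reduces_nil_iff (hsym : ∀ a b : V, I a b → I b a) {w v : List (Op V)}
    (h : MCong I w v) : Reduces I w [] ↔ Reduces I v [] := by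
  induction h with
  | rel x y h =>
    refine ⟨fun hx => ?_, fun hy => .head h hy⟩
    rcases h with ⟨s, t, a, b, hab⟩ | ⟨s, t, o⟩
    · exact .head (.swap s t b a (hsym _ _ hab)) hx
    · refine Contracts.reduces_nil hsym hx ?_
      simpa using Contracts.mk (I := I) s [] t (.pos o) (.neg o) ⟨o, .inl ⟨rfl, rfl⟩⟩ (by simp)
  | refl => rfl
  | symm _ _ _ ih => exact ih.symm
  | trans _ _ _ _ _ ih₁ ih₂ => exact ih₁.trans ih₂

theorem Reduces.eq_nil_or_contracts (hsym : ∀ a b : V, I a b → I b a) {w : List (Op V)}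
    (h : Reduces I w []) : w = [] ∨ ∃ v, Contracts I w v := by
  induction h using Relation.ReflTransGen.head_induction_on with
  | refl => exact .inl rfl
  | head hstep _ ih =>
    right
    rcases hstep with ⟨s, t, a, b, hab⟩ | ⟨s, t, o⟩
    · obtain ⟨v, hv⟩ := ih.resolve_left (by simp)
      obtain ⟨v', hv', -⟩ :=
        Contracts.exists_of_swap (s := s) (t := t) hsym (hsym _ _ hab) (by simpa using hv)
      exact ⟨v', by simpa using hv'⟩
    · exact ⟨_, by
        simpa using Contracts.mk (I := I) s [] t (.pos o) (.neg o) ⟨o, .inl ⟨rfl, rfl⟩⟩ (by simp)⟩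

theorem IrreducibleComp.not_contracts {w v : List (Op V)} (hirr : IrreducibleComp I w) :
    ¬ Contracts I w v := by
  rintro ⟨s, u, t, x, y, ⟨o, ⟨rfl, rfl⟩ | ⟨rfl, rfl, ho⟩⟩, hu⟩
  · exact hirr ⟨s, u, t, o, .inl ⟨by simp, hu⟩⟩
  · exact hirr ⟨s, u, t, o, .inr ⟨by simp, ho, hu⟩⟩

end GraphMonoid

/-- If `w` is an irreducible computation with `⟦w⟧ = 1`, then `w` is the empty
word; equivalently, every nonempty computation `w` with `⟦w⟧ = 1` is not
irreducible. -/
theorem irreducible_one_eq_nil {V : Type} (I : V → V → Prop)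
    (hsym : ∀ a b : V, I a b → I b a)
    (w : List (Op V)) (hirr : IrreducibleComp I w) (hone : MCong I w []) :
    w = [] := by
  rcases Reduces.eq_nil_or_contracts hsym ((hone.reduces_nil_iff hsym).2 .refl) with h | ⟨v, hv⟩
  · exact h
  · exact absurd hv hirr.not_contracts
end

section
/- Let G be the disjoint union of graphs G₀ = (V₀, I₀) and G₁ = (V₁, I₁), i.e., V = V₀ ⊔ V₁ and I = I₀ ∪ I₁ with no pair (o₀, o₁) ∈ I for o₀ ∈ V₀, o₁ ∈ V₁. Let n ≥ 1 and w = u₁·u₂⋯uₙ where each uⱼ is a nonempty word over Ops_{iⱼ} = {o⁺,o⁻ : o ∈ V_{iⱼ}} with iⱼ ∈ {0,1} and i_{j+1} ≠ iⱼ for all j. If ⟦w⟧ = 1, then ⟦u_ℓ⟧ = 1 for some ℓ ∈ {1, …, n}. -/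
/-- The congruence on the free monoid of computations whose quotient is the graph monoid. -/
def graphCon {V : Type} (I : V → V → Prop) : Con (FreeMonoid (Op V)) where
  r v w := MCong I v.toList w.toList
  iseqv := ⟨fun _ => .refl _, fun h => h.symm _ _, fun h h' => h.trans _ _ _ h'⟩
  mul' := by
    have left (c : List (Op V)) {v w : List (Op V)} (h : MCong I v w) :
        MCong I (c ++ v) (c ++ w) := by
      induction h with
      | rel _ _ h =>
        refine .rel _ _ ?_
        cases h with
        | swap s t a b h => simpa using MGen.swap (c ++ s) t a b h
        | cancel s t o => simpa using MGen.cancel (I := I) (c ++ s) t o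
      | refl => exact .refl _
      | symm _ _ _ ih => exact ih.symm _ _
      | trans _ _ _ _ _ ih ih' => exact ih.trans _ _ _ ih'
    have right (c : List (Op V)) {v w : List (Op V)} (h : MCong I v w) :
        MCong I (v ++ c) (w ++ c) := by
      induction h with
      | rel _ _ h =>
        refine .rel _ _ ?_
        cases h with
        | swap s t a b h => simpa using MGen.swap s (t ++ c) a b h
        | cancel s t o => simpa using MGen.cancel (I := I) s (t ++ c) o
      | refl => exact .refl _
      | symm _ _ _ ih => exact ih.symm _ _
      | trans _ _ _ _ _ ih ih' => exact ih.trans _ _ _ ih'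
    intro v v' w w' h h'
    exact (right w.toList h).trans _ _ _ (left v'.toList h')

/-- The class of a computation in the graph monoid. -/
def graphClass {V : Type} (I : V → V → Prop) (w : List (Op V)) : (graphCon I).Quotient :=
  (graphCon I).mk' (FreeMonoid.ofList w)

theorem graphClass_eq_iff {V : Type} {I : V → V → Prop} {v w : List (Op V)} :
    graphClass I v = graphClass I w ↔ MCong I v w :=
  (graphCon I).eq

theorem graphClass_append {V : Type} (I : V → V → Prop) (v w : List (Op V)) :
    graphClass I (v ++ w) = graphClass I v * graphClass I w :=
  rfl

/-- The map from computations to the free product of two copies of the graph monoid that sends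
each operation to the copy given by the part of its symbol. -/
def coprodClass {V : Type} (I : V → V → Prop) (P : V → Bool) (w : List (Op V)) :
    Monoid.CoprodI fun _ : Bool => (graphCon I).Quotient :=
  (w.map fun a => Monoid.CoprodI.of (i := P a.sym) (graphClass I [a])).prod

theorem coprodClass_append {V : Type} (I : V → V → Prop) (P : V → Bool) (v w : List (Op V)) :
    coprodClass I P (v ++ w) = coprodClass I P v * coprodClass I P w := by
  simp [coprodClass]

/-- A computation over one part is sent to its class in the corresponding copy. -/
theorem coprodClass_of_forall_sym {V : Type} (I : V → V → Prop) (P : V → Bool) (b : Bool)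
    (w : List (Op V)) (hw : ∀ a ∈ w, P a.sym = b) :
    coprodClass I P w =
      Monoid.CoprodI.of (M := fun _ : Bool => (graphCon I).Quotient) (i := b)
        (graphClass I w) := by
  induction w with
  | nil => exact (map_one _).symm
  | cons a w ih =>
    obtain ⟨rfl, hw⟩ := List.forall_mem_cons.1 hw
    rw [← List.singleton_append, coprodClass_append, ih hw, graphClass_append, map_mul]
    simp [coprodClass]

theorem coprodClass_eq_of_mCong {V : Type} {I : V → V → Prop} {P : V → Bool}
    (hcross : ∀ o₁ o₂ : V, P o₁ ≠ P o₂ → ¬ I o₁ o₂) {v w : List (Op V)} (h : MCong I v w) :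
    coprodClass I P v = coprodClass I P w := by
  induction h with
  | rel _ _ h =>
    cases h with
    | swap s t a b h =>
      have hab : P b.sym = P a.sym := by
        by_contra hne
        exact hcross _ _ (Ne.symm hne) h
      have heq : graphClass I [a, b] = graphClass I [b, a] :=
        graphClass_eq_iff.2 (.rel _ _ (by simpa using MGen.swap (I := I) [] [] a b h))
      simp only [coprodClass_append]
      rw [coprodClass_of_forall_sym I P (P a.sym) [a, b] (by simp [hab]),
        coprodClass_of_forall_sym I P (P a.sym) [b, a] (by simp [hab]), heq]
    | cancel s t o =>
      have heq : graphClass I [Op.pos o, Op.neg o] = 1 :=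
        graphClass_eq_iff.2 (.rel _ _ (by simpa using MGen.cancel (I := I) [] [] o))
      simp only [coprodClass_append]
      rw [coprodClass_of_forall_sym I P (P o) [Op.pos o, Op.neg o] (by simp [Op.sym]), heq,
        map_one, mul_one]
  | refl => rfl
  | symm _ _ _ ih => exact ih.symm
  | trans _ _ _ _ _ ih ih' => exact ih.trans ih'

theorem coprodClass_flatten {V : Type} (I : V → V → Prop) (P : V → Bool)
    (l : List (List (Op V))) :
    coprodClass I P l.flatten = (l.map (coprodClass I P)).prod := by
  induction l with
  | nil => rfl
  | cons w l ih => rw [List.flatten_cons, coprodClass_append, ih, List.map_cons, List.prod_cons]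

/-- Let `G` be the disjoint union of `G₀` and `G₁` (classes given by `P : V → Bool`,
with no independence across the two parts).  If `w = u₁ ⋯ uₙ` where each `uⱼ` is a
nonempty word over the operations of one part and consecutive `uⱼ` use different
parts, then `⟦w⟧ = 1` implies `⟦u_ℓ⟧ = 1` for some `ℓ`. -/
theorem disjoint_union_factor_one {V : Type} (I : V → V → Prop)
    (hsym : ∀ a b : V, I a b → I b a)
    (P : V → Bool)
    (hcross : ∀ o₁ o₂ : V, P o₁ ≠ P o₂ → ¬ I o₁ o₂)
    (n : ℕ) (hn : 1 ≤ n) (u : Fin n → List (Op V))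
    (hne : ∀ j, u j ≠ [])
    (cls : Fin n → Bool)
    (hcls : ∀ j, ∀ a ∈ u j, P (Op.sym a) = cls j)
    (halt : ∀ (j : ℕ) (h : j + 1 < n), cls ⟨j + 1, h⟩ ≠ cls ⟨j, by omega⟩)
    (hone : MCong I (List.ofFn u).flatten []) :
    ∃ ℓ : Fin n, MCong I (u ℓ) [] := by
  classical
  by_contra! hnot
  let W : Monoid.CoprodI.Word fun _ : Bool => (graphCon I).Quotient :=
    { toList := List.ofFn fun j => ⟨cls j, graphClass I (u j)⟩
      ne_one := by
        intro l hl
        obtain ⟨j, rfl⟩ := (List.mem_ofFn' _ _).1 hl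
        exact fun h => hnot j (graphClass_eq_iff.1 h)
      chain_ne := by
        rw [List.isChain_iff_getElem]
        intro j hj
        simpa using (halt j (by simpa using hj)).symm }
  have hW : W.prod = 1 := by
    have h := coprodClass_eq_of_mCong hcross hone
    rw [coprodClass_flatten, List.map_ofFn] at h
    rw [Monoid.CoprodI.Word.prod, List.map_ofFn]
    refine Eq.trans (congrArg List.prod (congrArg List.ofFn ?_)) h
    funext j
    exact (coprodClass_of_forall_sym I P (cls j) (u j) (hcls j)).symm
  have hempty : W = Monoid.CoprodI.Word.empty :=
    Monoid.CoprodI.Word.equiv.symm.injective (hW.trans Monoid.CoprodI.Word.prod_empty.symm)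
  have hlen : W.toList.length = 0 := by rw [hempty]; rfl
  simp only [W, List.length_ofFn] at hlen
  omega
end

section
/- Let φ = C₁ ∧ ⋯ ∧ C_m (m ≥ 1) be a 3CNF formula over the variables x₁, …, xₙ. Over the alphabet Σ = {0, 1, #}, define the languages L₀ = { w₁ # rev(w₁) # w₂ # rev(w₂) # ⋯ w_m # rev(w_m) # : for each j ∈ {1,…,m}, wⱼ ∈ {0,1}ⁿ satisfies Cⱼ } and L₁ = { w₀ # w₁ # rev(w₁) # ⋯ w_{m−1} # rev(w_{m−1}) # w_m # : wⱼ ∈ {0,1}ⁿ for each j ∈ {0,…,m} }. Then φ is satisfiable if and only if L₀ ∩ L₁ ∩ Σ^{2m(n+1)} ≠ ∅, where Σ^{2m(n+1)} denotes the set of words over Σ of length exactly 2m(n+1). -/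
/-- Encode a bit string as a word over the alphabet `Σ = {0, 1, #}`, which we model
as `Option Bool` (`some b` is the bit `b`, `none` is the separator `#`). -/
def encBits (w : List Bool) : List (Option Bool) := w.map some

/-- A clause over variables `x₁, …, xₙ` is a list of literals; a literal `(b, i)`
demands that variable `xᵢ` takes the value `b`. -/
def ClauseSat {n : ℕ} (α : Fin n → Bool) (C : List (Bool × Fin n)) : Prop :=
  ∃ l ∈ C, α l.2 = l.1

/-- A bit string `w` of length `n` satisfies a clause if the assignment it encodes
(`xᵢ ↦` the `i`-th bit of `w`) does. -/
def WordSat {n : ℕ} (w : List Bool) (C : List (Bool × Fin n)) : Prop :=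
  ∃ l ∈ C, w.getD l.2 false = l.1

/-- The language `L₀ = { w₁ # rev(w₁) # ⋯ w_m # rev(w_m) # : wⱼ ∈ {0,1}ⁿ satisfies Cⱼ }`. -/
def Lzero (n m : ℕ) (C : Fin m → List (Bool × Fin n)) : Set (List (Option Bool)) :=
  {x | ∃ ws : Fin m → List Bool,
    (∀ j, (ws j).length = n ∧ WordSat (ws j) (C j)) ∧
    x = (List.ofFn fun j : Fin m =>
      encBits (ws j) ++ [none] ++ encBits (ws j).reverse ++ [none]).flatten}

/-- The language
`L₁ = { w₀ # w₁ # rev(w₁) # ⋯ w_{m-1} # rev(w_{m-1}) # w_m # : wⱼ ∈ {0,1}ⁿ }`. -/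
def Lone (n m : ℕ) : Set (List (Option Bool)) :=
  {x | ∃ ws : Fin (m + 1) → List Bool,
    (∀ j, (ws j).length = n) ∧
    x = encBits (ws 0) ++ [none] ++
      (List.ofFn fun j : Fin (m - 1) =>
        encBits (ws ⟨j.1 + 1, by omega⟩) ++ [none] ++
          encBits (ws ⟨j.1 + 1, by omega⟩).reverse ++ [none]).flatten ++
      encBits (ws ⟨m, by omega⟩) ++ [none]}

theorem encBits_injective : Function.Injective encBits :=
  List.map_injective_iff.mpr (Option.some_injective _)

/-- Cancelling a leading block of fixed length followed by a separator. -/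
theorem encBits_separator_cancel {u v : List Bool} (h : u.length = v.length)
    {s t : List (Option Bool)} (e : encBits u ++ none :: s = encBits v ++ none :: t) :
    u = v ∧ s = t := by
  have := List.append_inj e (by simpa [encBits] using h)
  exact ⟨encBits_injective this.1, by simpa using this.2⟩

/-- Words of the shapes used in `Lzero` and `Lone` can only coincide if all the blocks of the
former are equal to the first block of the latter. -/
theorem blocks_eq_of_flatten_eq {n : ℕ} (k : ℕ) (w : Fin (k + 1) → List Bool) (a z : List Bool)
    (u : Fin k → List Bool) (hw : ∀ j, (w j).length = n) (ha : a.length = n)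
    (hu : ∀ j, (u j).length = n)
    (e : (List.ofFn fun j => encBits (w j) ++ [none] ++ encBits (w j).reverse ++ [none]).flatten =
      encBits a ++ [none] ++
        (List.ofFn fun j => encBits (u j) ++ [none] ++ encBits (u j).reverse ++ [none]).flatten ++
        encBits z ++ [none]) :
    ∀ j, w j = a := by
  induction k generalizing a with
  | zero =>
    intro j
    obtain rfl := Fin.fin_one_eq_zero j
    simp only [List.ofFn_succ, List.flatten_cons, List.append_assoc, List.cons_append,
      List.nil_append] at e
    exact (encBits_separator_cancel ((hw 0).trans ha.symm) e).1
  | succ k ih =>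
    rw [List.ofFn_succ,
      List.ofFn_succ (f := fun j => encBits (u j) ++ [none] ++ encBits (u j).reverse ++ [none])] at e
    simp only [List.flatten_cons, List.append_assoc, List.cons_append,
      List.nil_append] at e
    obtain ⟨h0, e⟩ := encBits_separator_cancel ((hw 0).trans ha.symm) e
    obtain ⟨h1, e⟩ :=
      encBits_separator_cancel (u := (w 0).reverse) (v := u 0) (by simp [hw, hu]) e
    have key := ih (fun j => w j.succ) (u 0).reverse (fun j => u j.succ) (fun j => hw _)
      (by simp [hu]) (fun j => hu _) (by simpa using e)
    refine Fin.cases h0 fun j => ?_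
    rw [key j, ← h1, List.reverse_reverse, h0]

theorem flatten_ofFn_const_append {α : Type*} (A B : List α) (k : ℕ) :
    (List.ofFn fun _ : Fin (k + 1) => A ++ B).flatten =
      A ++ (List.ofFn fun _ : Fin k => B ++ A).flatten ++ B := by
  induction k with
  | zero => simp
  | succ k ih =>
    rw [List.ofFn_succ, List.flatten_cons, ih, List.ofFn_succ (n := k), List.flatten_cons]
    simp only [List.append_assoc]

theorem wordSat_iff_clauseSat {n : ℕ} (w : List Bool) (C : List (Bool × Fin n)) :
    WordSat w C ↔ ClauseSat (fun i : Fin n => w.getD i false) C :=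
  Iff.rfl

/-- A 3CNF formula `φ = C₁ ∧ ⋯ ∧ C_m` (`m ≥ 1`, each clause having at most three
literals) over `x₁, …, xₙ` is satisfiable iff `L₀ ∩ L₁ ∩ Σ^{2m(n+1)} ≠ ∅`. -/
theorem sat_iff_intersection (n m : ℕ) (hm : 1 ≤ m)
    (C : Fin m → List (Bool × Fin n))
    (h3 : ∀ j, (C j).length ≤ 3) :
    (∃ α : Fin n → Bool, ∀ j, ClauseSat α (C j)) ↔
      ∃ x : List (Option Bool),
        x ∈ Lzero n m C ∧ x ∈ Lone n m ∧ x.length = 2 * m * (n + 1) := by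
  obtain ⟨k, rfl⟩ : ∃ k, m = k + 1 := ⟨m - 1, by omega⟩
  constructor
  · rintro ⟨α, hα⟩
    set w := List.ofFn α with hw
    have hlen : w.length = n := by simp [hw]
    have hget : (fun i : Fin n => w.getD i false) = α := by
      funext i
      simp [hw]
    refine ⟨_, ⟨fun _ => w, fun j => ⟨hlen, ?_⟩, rfl⟩,
      ⟨fun j => if j = 0 then w else w.reverse, fun j => ?_, ?_⟩, ?_⟩
    · rw [wordSat_iff_clauseSat, hget]
      exact hα j
    · dsimp only
      split_ifs <;> simp [hlen]
    · have := flatten_ofFn_const_append (encBits w ++ [none]) (encBits w.reverse ++ [none]) k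
      simpa [Fin.ext_iff] using this
    · simp [encBits, hlen, List.length_flatten]
      ring
  · rintro ⟨x, ⟨w, hw, hx⟩, ⟨u, hu, hx'⟩, -⟩
    have key := blocks_eq_of_flatten_eq (n := n) k w (u 0) _ _ (fun j => (hw j).1) (hu 0)
      (fun j => hu _) (hx.symm.trans hx')
    refine ⟨fun i => (u 0).getD i false, fun j => ?_⟩
    rw [← wordSat_iff_clauseSat, ← key j]
    exact (hw j).2
end
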